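/- arXiv:2202.10009 — 4 statements merged into one kernel-verified Lean document; each statement's English description precedes it below -/
import Mathlib

section
/- Let V be an arbitrary variety and suppose V contains an algebra A whose congruence lattice contains a pentagon sublattice {0, β, δ, θ, α} (with δ < θ, β ∧ θ = β ∧ δ = 0, β ∨ δ = β ∨ θ = α) such that C(θ,θ;δ) holds and C(β,θ;δ) fails. Then V contains an algebra B whose congruence lattice contains a pentagon sublattice {0, β', δ', θ', α'} (ordered the same way) satisfying C(α',α';β') and C(θ',θ';0). -/
/-- A (universal-algebraic) signature: a type of operation symbols with arities. -/
structure Sig where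
  ops : Type
  arity : ops → ℕ

/-- An algebra for a signature: a carrier set with an interpretation of each
operation symbol. -/
structure Alg (σ : Sig) where
  carrier : Type
  interp : ∀ f : σ.ops, (Fin (σ.arity f) → carrier) → carrier

/-- Terms over a signature with variables from `V`. -/
inductive Trm (σ : Sig) (V : Type) : Type
  | var : V → Trm σ V
  | op : (f : σ.ops) → (Fin (σ.arity f) → Trm σ V) → Trm σ V

/-- Evaluation of a term in an algebra under an assignment of the variables. -/
def Alg.evalTrm {σ : Sig} (A : Alg σ) {V : Type} (asg : V → A.carrier) :
    Trm σ V → A.carrier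
  | .var v => asg v
  | .op f ts => A.interp f fun i => A.evalTrm asg (ts i)

/-- A congruence on an algebra: an equivalence relation compatible with the
basic operations. -/
structure Congruence {σ : Sig} (A : Alg σ) where
  rel : A.carrier → A.carrier → Prop
  iseqv : Equivalence rel
  compat : ∀ (f : σ.ops) (a b : Fin (σ.arity f) → A.carrier),
    (∀ i, rel (a i) (b i)) → rel (A.interp f a) (A.interp f b)

namespace Congruence

variable {σ : Sig} {A : Alg σ}

theorem ext' {c d : Congruence A} (h : c.rel = d.rel) : c = d := by
  cases c; cases d; cases h; rfl

instance : PartialOrder (Congruence A) where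
  le c d := ∀ a b, c.rel a b → d.rel a b
  le_refl c a b h := h
  le_trans c d e h1 h2 a b h := h2 a b (h1 a b h)
  le_antisymm c d h1 h2 :=
    ext' (funext fun a => funext fun b => propext ⟨h1 a b, h2 a b⟩)

instance : InfSet (Congruence A) where
  sInf S :=
    { rel := fun a b => ∀ c ∈ S, c.rel a b
      iseqv := ⟨fun a c _ => c.iseqv.refl a,
                fun h c hc => c.iseqv.symm (h c hc),
                fun h1 h2 c hc => c.iseqv.trans (h1 c hc) (h2 c hc)⟩
      compat := fun f a b h c hc => c.compat f a b fun i => h i c hc }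

/-- The congruences of an algebra form a complete lattice (`⊥` is the equality
congruence, `⊤` is the total congruence, meet is intersection). -/
instance : CompleteLattice (Congruence A) :=
  completeLatticeOfInf _ fun S =>
    ⟨fun c hc a b h => h c hc, fun c hc a b h d hd => hc hd a b h⟩

end Congruence

/-- `Centralizes S T δ` is the centralizer relation `C(S,T;δ)`: for every
`S,T`-matrix `[[p,q],[r,s]]` (built from a term operation `t`, tuples `a S b`
and `u T v`), if `(p,q) ∈ δ` then `(r,s) ∈ δ`. -/
def Centralizes {σ : Sig} {A : Alg σ} (S T δ : Congruence A) : Prop :=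
  ∀ (m n : ℕ) (t : Trm σ (Sum (Fin m) (Fin n)))
    (a b : Fin m → A.carrier) (u v : Fin n → A.carrier),
    (∀ i, S.rel (a i) (b i)) → (∀ j, T.rel (u j) (v j)) →
    δ.rel (A.evalTrm (Sum.elim a u) t) (A.evalTrm (Sum.elim a v) t) →
    δ.rel (A.evalTrm (Sum.elim b u) t) (A.evalTrm (Sum.elim b v) t)

/-- The commC `[S,T]`: the least congruence `δ` with `C(S,T;δ)`. -/
def commC {σ : Sig} {A : Alg σ} (S T : Congruence A) : Congruence A :=
  sInf {δ | Centralizes S T δ}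

/-- The relative commC `[S,T]_ε`: the intersection of all congruences
`γ ≥ ε` with `C(S,T;γ)`. -/
def relCommC {σ : Sig} {A : Alg σ} (S T ε : Congruence A) : Congruence A :=
  sInf {γ | ε ≤ γ ∧ Centralizes S T γ}

/-- The congruence generated by a single pair `(x, y)`. -/
def cgPair {σ : Sig} (A : Alg σ) (x y : A.carrier) : Congruence A :=
  sInf {c | c.rel x y}

/-- Homomorphisms of algebras. -/
structure UAHom {σ : Sig} (A B : Alg σ) where
  toFun : A.carrier → B.carrier
  map_op : ∀ (f : σ.ops) (a : Fin (σ.arity f) → A.carrier),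
    toFun (A.interp f a) = B.interp f (fun i => toFun (a i))

/-- The product of a family of algebras. -/
def prodAlg {σ : Sig} {I : Type} (F : I → Alg σ) : Alg σ where
  carrier := ∀ i, (F i).carrier
  interp f a := fun i => (F i).interp f (fun j => a j i)

/-- A variety: a class of algebras of a fixed signature closed under
homomorphic images, subalgebras (here: isomorphic copies of subalgebras,
i.e. sources of injective homomorphisms), and arbitrary products. -/
structure Variety (σ : Sig) where
  Mem : Alg σ → Prop
  closed_hom : ∀ {A B : Alg σ}, Mem A →
    (∃ h : UAHom A B, Function.Surjective h.toFun) → Mem B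
  closed_sub : ∀ {A B : Alg σ}, Mem A →
    (∃ h : UAHom B A, Function.Injective h.toFun) → Mem B
  closed_prod : ∀ {I : Type} (F : I → Alg σ), (∀ i, Mem (F i)) → Mem (prodAlg F)

/-- The setoid associated with a congruence. -/
def Congruence.setoid {σ : Sig} {A : Alg σ} (c : Congruence A) :
    Setoid A.carrier := ⟨c.rel, c.iseqv⟩

/-- The quotient algebra of an algebra by a congruence. -/
noncomputable def quotAlg {σ : Sig} (A : Alg σ) (c : Congruence A) : Alg σ where
  carrier := Quotient c.setoid
  interp f a := Quotient.mk c.setoid (A.interp f fun i => (a i).out)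

/-- `algOn A α` is the algebra `A(α)`: the subalgebra of `A × A` whose
universe is `α`. -/
def algOn {σ : Sig} (A : Alg σ) (α : Congruence A) : Alg σ where
  carrier := {p : A.carrier × A.carrier // α.rel p.1 p.2}
  interp f a := ⟨(A.interp f fun i => (a i).1.1, A.interp f fun i => (a i).1.2),
    α.compat f _ _ fun i => (a i).2⟩

/-- The kernel of the first coordinate projection of `A(α)`. -/
def eta1 {σ : Sig} (A : Alg σ) (α : Congruence A) : Congruence (algOn A α) where
  rel p q := p.1.1 = q.1.1
  iseqv := ⟨fun _ => rfl, Eq.symm, Eq.trans⟩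
  compat f a b h := congrArg (A.interp f) (funext h)

/-- The kernel of the second coordinate projection of `A(α)`. -/
def eta2 {σ : Sig} (A : Alg σ) (α : Congruence A) : Congruence (algOn A α) where
  rel p q := p.1.2 = q.1.2
  iseqv := ⟨fun _ => rfl, Eq.symm, Eq.trans⟩
  compat f a b h := congrArg (A.interp f) (funext h)

/-- The congruence `Δ_{α,β}` on `A(α)` generated by the `β`-diagonal pairs. -/
def diagDelta {σ : Sig} (A : Alg σ) (α β : Congruence A) :
    Congruence (algOn A α) :=
  sInf {c | ∀ x z : A.carrier, β.rel x z →
    c.rel ⟨(x, x), α.iseqv.refl x⟩ ⟨(z, z), α.iseqv.refl z⟩}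

/-- A pentagon (five-element sublattice isomorphic to `N₅`) in the congruence
lattice with bottom `z`, side element `β`, critical chain `δ < θ`, and top `α`. -/
def IsPentagon {σ : Sig} {A : Alg σ} (z β δ θ α : Congruence A) : Prop :=
  δ < θ ∧ β ⊓ θ = z ∧ β ⊓ δ = z ∧ β ⊔ δ = α ∧ β ⊔ θ = α

/-- Two congruences permute: `c ∘ d = d ∘ c`. -/
def Permutes {σ : Sig} {A : Alg σ} (c d : Congruence A) : Prop :=
  ∀ a b : A.carrier, (∃ x, c.rel a x ∧ d.rel x b) ↔ (∃ x, d.rel a x ∧ c.rel x b)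

/-- `T` is a Taylor term for the variety `V`: an idempotent term satisfying an
`i`-th place Taylor identity for every place `i`. -/
def IsTaylorTrm {σ : Sig} (V : Variety σ) {n : ℕ} (T : Trm σ (Fin n)) : Prop :=
  0 < n ∧
  (∀ A : Alg σ, V.Mem A → ∀ c : A.carrier, A.evalTrm (fun _ => c) T = c) ∧
  (∀ i : Fin n, ∃ w z : Fin n → Bool, w i ≠ z i ∧
    ∀ A : Alg σ, V.Mem A → ∀ x y : A.carrier,
      A.evalTrm (fun j => cond (w j) x y) T = A.evalTrm (fun j => cond (z j) x y) T)

/-- `V` has a Taylor term. -/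
def HasTaylorTrm {σ : Sig} (V : Variety σ) : Prop :=
  ∃ (n : ℕ) (T : Trm σ (Fin n)), IsTaylorTrm V T

/-- A congruence is abelian if `[α,α] = 0`. -/
def IsAbelianCong {σ : Sig} {A : Alg σ} (α : Congruence A) : Prop :=
  commC α α = ⊥

/-- `d` is a weak difference term for `V`: `d(a,a,b) = b` and `d(a,b,b) = a`
whenever the pair `(a,b)` lies in an abelian congruence of a member of `V`. -/
def IsWeakDifferenceTrm {σ : Sig} (V : Variety σ) (d : Trm σ (Fin 3)) : Prop :=
  ∀ A : Alg σ, V.Mem A → ∀ α : Congruence A, IsAbelianCong α →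
    ∀ a b : A.carrier, α.rel a b →
      A.evalTrm ![a, a, b] d = b ∧ A.evalTrm ![a, b, b] d = a

/-- `d` is a difference term for `V`: `V ⊨ d(x,x,y) ≈ y` and `d(a,b,b) = a`
whenever the pair `(a,b)` lies in an abelian congruence of a member of `V`. -/
def IsDifferenceTrm {σ : Sig} (V : Variety σ) (d : Trm σ (Fin 3)) : Prop :=
  (∀ A : Alg σ, V.Mem A → ∀ a b : A.carrier, A.evalTrm ![a, a, b] d = b) ∧
  (∀ A : Alg σ, V.Mem A → ∀ α : Congruence A, IsAbelianCong α →
    ∀ a b : A.carrier, α.rel a b → A.evalTrm ![a, b, b] d = a)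

/-- The commC is left distributive throughout `V`. -/
def CommLeftDistrib {σ : Sig} (V : Variety σ) : Prop :=
  ∀ A : Alg σ, V.Mem A → ∀ x y z : Congruence A,
    commC (x ⊔ y) z = commC x z ⊔ commC y z

/-- The commC is right distributive throughout `V`. -/
def CommRightDistrib {σ : Sig} (V : Variety σ) : Prop :=
  ∀ A : Alg σ, V.Mem A → ∀ x y z : Congruence A,
    commC x (y ⊔ z) = commC x y ⊔ commC x z

/-- The commC is commutative throughout `V`. -/
def CommutativeCommutator {σ : Sig} (V : Variety σ) : Prop :=
  ∀ A : Alg σ, V.Mem A → ∀ x y : Congruence A, commC x y = commC y x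

/-- `V` is congruence modular. -/
def CongruenceModular {σ : Sig} (V : Variety σ) : Prop :=
  ∀ A : Alg σ, V.Mem A → IsModularLattice (Congruence A)

namespace BP

variable {σ : Sig} {A B : Alg σ}

theorem eval_hom (h : UAHom A B) {V : Type} (asg : V → A.carrier) (t : Trm σ V) :
    h.toFun (A.evalTrm asg t) = B.evalTrm (fun v => h.toFun (asg v)) t := by
  induction t with
  | var v => rfl
  | op f ts ih =>
    simp only [Alg.evalTrm, h.map_op]
    congr 1
    funext i
    exact ih i

theorem eval_hom_sum (h : UAHom A B) {m n : ℕ} (a : Fin m → A.carrier) (u : Fin n → A.carrier)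
    (t : Trm σ (Sum (Fin m) (Fin n))) :
    h.toFun (A.evalTrm (Sum.elim a u) t) =
      B.evalTrm (Sum.elim (fun i => h.toFun (a i)) (fun i => h.toFun (u i))) t := by
  rw [eval_hom]
  congr 1
  funext v
  cases v <;> rfl

theorem eval_rel (c : Congruence A) {V : Type} (x y : V → A.carrier)
    (h : ∀ v, c.rel (x v) (y v)) (t : Trm σ V) : c.rel (A.evalTrm x t) (A.evalTrm y t) := by
  induction t with
  | var v => exact h v
  | op f ts ih => exact c.compat f _ _ ih

/-- Preimage of a congruence under a homomorphism. -/
def comapC (h : UAHom A B) (c : Congruence B) : Congruence A where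
  rel x y := c.rel (h.toFun x) (h.toFun y)
  iseqv := ⟨fun _ => c.iseqv.refl _, fun h => c.iseqv.symm h, fun h k => c.iseqv.trans h k⟩
  compat f a b hab := by
    rw [h.map_op, h.map_op]
    exact c.compat f _ _ hab

theorem comap_centralizes (h : UAHom A B) {S T D : Congruence B} (hC : Centralizes S T D) :
    Centralizes (comapC h S) (comapC h T) (comapC h D) := by
  intro m n t a b u v hab huv hp
  change D.rel _ _ at hp
  change D.rel _ _
  rw [eval_hom_sum, eval_hom_sum] at hp ⊢
  exact hC m n t _ _ _ _ hab huv hp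

theorem centralizes_mono {S S' T T' D : Congruence A} (hS : S ≤ S') (hT : T ≤ T')
    (hC : Centralizes S' T' D) : Centralizes S T D :=
  fun m n t a b u v hab huv hp =>
    hC m n t a b u v (fun i => hS _ _ (hab i)) (fun i => hT _ _ (huv i)) hp

theorem inf_rel (c d : Congruence A) (x y : A.carrier) :
    (c ⊓ d).rel x y ↔ c.rel x y ∧ d.rel x y := by
  constructor
  · intro h
    exact ⟨(inf_le_left : c ⊓ d ≤ c) _ _ h, (inf_le_right : c ⊓ d ≤ d) _ _ h⟩
  · rintro ⟨h1, h2⟩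
    let e : Congruence A :=
      { rel := fun x y => c.rel x y ∧ d.rel x y
        iseqv := ⟨fun x => ⟨c.iseqv.refl x, d.iseqv.refl x⟩,
          fun h => ⟨c.iseqv.symm h.1, d.iseqv.symm h.2⟩,
          fun h k => ⟨c.iseqv.trans h.1 k.1, d.iseqv.trans h.2 k.2⟩⟩
        compat := fun f a b h =>
          ⟨c.compat f a b fun i => (h i).1, d.compat f a b fun i => (h i).2⟩ }
    have h3 : e ≤ c ⊓ d := le_inf (fun _ _ h => h.1) (fun _ _ h => h.2)
    exact h3 x y ⟨h1, h2⟩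

theorem bot_rel (x y : A.carrier) : (⊥ : Congruence A).rel x y ↔ x = y := by
  constructor
  · intro h
    let e : Congruence A :=
      { rel := fun x y => x = y
        iseqv := ⟨fun _ => rfl, Eq.symm, Eq.trans⟩
        compat := fun f a b h => congrArg (A.interp f) (funext h) }
    exact (bot_le : ⊥ ≤ e) x y h
  · rintro rfl
    exact (⊥ : Congruence A).iseqv.refl x

/-- The join of two congruences, explicitly, as the generated equivalence. -/
def joinC (c d : Congruence A) : Congruence A where
  rel := Relation.EqvGen fun x y => c.rel x y ∨ d.rel x y
  iseqv := Relation.EqvGen.is_equivalence _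
  compat f a b hab := by
    classical
    have step : ∀ (w : Fin (σ.arity f) → A.carrier) (i : Fin (σ.arity f)) (x y : A.carrier),
        Relation.EqvGen (fun x y => c.rel x y ∨ d.rel x y) x y →
        Relation.EqvGen (fun x y => c.rel x y ∨ d.rel x y)
          (A.interp f (Function.update w i x)) (A.interp f (Function.update w i y)) := by
      intro w i x y h
      induction h with
      | rel x y h =>
        apply Relation.EqvGen.rel
        rcases h with h | h
        · left
          apply c.compat
          intro j
          by_cases hj : j = i
          · subst hj; simpa using h
          · simpa [hj] using c.iseqv.refl _
        · right
          apply d.compat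
          intro j
          by_cases hj : j = i
          · subst hj; simpa using h
          · simpa [hj] using d.iseqv.refl _
      | refl x => exact Relation.EqvGen.refl _
      | symm x y _ ih => exact Relation.EqvGen.symm _ _ ih
      | trans x y z _ _ ih1 ih2 => exact Relation.EqvGen.trans _ _ _ ih1 ih2
    have main : ∀ s : Finset (Fin (σ.arity f)),
        Relation.EqvGen (fun x y => c.rel x y ∨ d.rel x y)
          (A.interp f a) (A.interp f (s.piecewise b a)) := by
      intro s
      induction s using Finset.induction_on with
      | empty => simpa using Relation.EqvGen.refl _
      | insert i s hi ih =>
        refine Relation.EqvGen.trans _ _ _ ih ?_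
        have h1 := step (s.piecewise b a) i (a i) (b i) (hab i)
        rw [Finset.piecewise_insert]
        have h2 : Function.update (s.piecewise b a) i (a i) = s.piecewise b a := by
          have : a i = s.piecewise b a i := by simp [hi]
          rw [this, Function.update_eq_self]
        rwa [h2] at h1
    simpa using main Finset.univ

theorem joinC_le {c d e : Congruence A} (h1 : c ≤ e) (h2 : d ≤ e) : joinC c d ≤ e := by
  intro x y h
  change Relation.EqvGen _ x y at h
  induction h with
  | rel x y h => exact h.elim (h1 x y) (h2 x y)
  | refl x => exact e.iseqv.refl x
  | symm x y _ ih => exact e.iseqv.symm ih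
  | trans x y z _ _ ih1 ih2 => exact e.iseqv.trans ih1 ih2

theorem left_le_joinC (c d : Congruence A) : c ≤ joinC c d :=
  fun _ _ h => Relation.EqvGen.rel _ _ (Or.inl h)

theorem right_le_joinC (c d : Congruence A) : d ≤ joinC c d :=
  fun _ _ h => Relation.EqvGen.rel _ _ (Or.inr h)

/-! Quotients -/

/-- The quotient map. -/
noncomputable def quotHom (A : Alg σ) (z : Congruence A) : UAHom A (quotAlg A z) where
  toFun := Quotient.mk z.setoid
  map_op f a := by
    apply Quotient.sound
    exact z.compat f _ _ fun i => z.iseqv.symm (Quotient.mk_out (s := z.setoid) (a i))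

theorem quotHom_out (z : Congruence A) (x : (quotAlg A z).carrier) :
    (quotHom A z).toFun (Quotient.out (s := z.setoid) x) = x :=
  Quotient.out_eq (s := z.setoid) x

theorem out_quotHom (z : Congruence A) (x : A.carrier) :
    z.rel (Quotient.out (s := z.setoid) ((quotHom A z).toFun x)) x :=
  Quotient.mk_out (s := z.setoid) x

/-- Image of a congruence `c ≥ z` in the quotient by `z`. -/
noncomputable def pushC (z c : Congruence A) (hz : z ≤ c) : Congruence (quotAlg A z) where
  rel x y := c.rel (Quotient.out (s := z.setoid) x) (Quotient.out (s := z.setoid) y)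
  iseqv := ⟨fun _ => c.iseqv.refl _, fun h => c.iseqv.symm h, fun h k => c.iseqv.trans h k⟩
  compat f a b hab := by
    have h1 := hz _ _ (out_quotHom z (A.interp f fun i => Quotient.out (s := z.setoid) (a i)))
    have h2 := hz _ _ (out_quotHom z (A.interp f fun i => Quotient.out (s := z.setoid) (b i)))
    exact c.iseqv.trans h1 (c.iseqv.trans (c.compat f _ _ hab) (c.iseqv.symm h2))

theorem pushC_mk (z c : Congruence A) (hz : z ≤ c) (x y : A.carrier) :
    (pushC z c hz).rel ((quotHom A z).toFun x) ((quotHom A z).toFun y) ↔ c.rel x y := by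
  have h1 := hz _ _ (out_quotHom z x)
  have h2 := hz _ _ (out_quotHom z y)
  constructor
  · intro h
    exact c.iseqv.trans (c.iseqv.symm h1) (c.iseqv.trans h h2)
  · intro h
    exact c.iseqv.trans h1 (c.iseqv.trans h (c.iseqv.symm h2))

theorem pushC_le {z c d : Congruence A} (hc : z ≤ c) (hd : z ≤ d) (h : c ≤ d) :
    pushC z c hc ≤ pushC z d hd := fun _ _ k => h _ _ k

theorem pushC_centralizes {z S T D : Congruence A} (hS : z ≤ S) (hT : z ≤ T) (hD : z ≤ D)
    (hC : Centralizes S T D) : Centralizes (pushC z S hS) (pushC z T hT) (pushC z D hD) := by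
  intro m n t a b u v hab huv hp
  have key : ∀ {k l : ℕ} (x : Fin k → (quotAlg A z).carrier) (y : Fin l → (quotAlg A z).carrier)
      (t : Trm σ (Sum (Fin k) (Fin l))),
      (quotAlg A z).evalTrm (Sum.elim x y) t = (quotHom A z).toFun
        (A.evalTrm (Sum.elim (fun i => Quotient.out (s := z.setoid) (x i))
          (fun i => Quotient.out (s := z.setoid) (y i))) t) := by
    intro k l x y t
    rw [eval_hom_sum]
    simp only [quotHom_out]
  rw [key, key, pushC_mk] at hp ⊢
  exact hC m n t _ _ _ _ hab huv hp

theorem pushC_sup {z b d a : Congruence A} (hb : z ≤ b) (hd : z ≤ d) (ha : z ≤ a)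
    (h : b ⊔ d = a) : pushC z b hb ⊔ pushC z d hd = pushC z a ha := by
  apply le_antisymm
  · exact sup_le (pushC_le _ _ (h ▸ le_sup_left)) (pushC_le _ _ (h ▸ le_sup_right))
  · set e := pushC z b hb ⊔ pushC z d hd with he
    have h1 : b ⊔ d ≤ comapC (quotHom A z) e := by
      apply sup_le
      · intro x y hxy
        exact (le_sup_left : pushC z b hb ≤ e) _ _ ((pushC_mk z b hb x y).2 hxy)
      · intro x y hxy
        exact (le_sup_right : pushC z d hd ≤ e) _ _ ((pushC_mk z d hd x y).2 hxy)
    rw [h] at h1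
    intro x y hxy
    have h2 := h1 _ _ hxy
    change e.rel _ _ at h2
    rwa [quotHom_out, quotHom_out] at h2

theorem pushC_inf {z b d : Congruence A} (hb : z ≤ b) (hd : z ≤ d)
    (h : b ⊓ d = z) : pushC z b hb ⊓ pushC z d hd = ⊥ := by
  apply le_antisymm _ bot_le
  intro x y hxy
  rw [inf_rel] at hxy
  have h1 : (b ⊓ d).rel _ _ := (inf_rel _ _ _ _).2 hxy
  rw [h] at h1
  rw [bot_rel, ← quotHom_out z x, ← quotHom_out z y]
  exact Quotient.sound (s := z.setoid) h1

theorem reduce (V : Variety σ) (A : Alg σ) (hA : V.Mem A) (z b d t a : Congruence A)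
    (hp : IsPentagon z b d t a) (h1 : Centralizes a a b) (h2 : Centralizes t t z) :
    ∃ B : Alg σ, V.Mem B ∧ ∃ β' δ' θ' α' : Congruence B,
      IsPentagon ⊥ β' δ' θ' α' ∧ Centralizes α' α' β' ∧
      Centralizes θ' θ' (⊥ : Congruence B) := by
  obtain ⟨hdt, hbt, hbd, sd, st⟩ := hp
  have zb : z ≤ b := hbt ▸ inf_le_left
  have zt : z ≤ t := hbt ▸ inf_le_right
  have zd : z ≤ d := hbd ▸ inf_le_right
  have za : z ≤ a := zb.trans (sd ▸ le_sup_left)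
  refine ⟨quotAlg A z, V.closed_hom hA ⟨quotHom A z, fun x => ⟨_, quotHom_out z x⟩⟩,
    pushC z b zb, pushC z d zd, pushC z t zt, pushC z a za,
    ⟨lt_of_le_not_ge (pushC_le _ _ hdt.le) ?_, pushC_inf _ _ hbt, pushC_inf _ _ hbd,
      pushC_sup _ _ _ sd, pushC_sup _ _ _ st⟩, pushC_centralizes _ _ _ h1, ?_⟩
  · intro hle
    apply hdt.not_ge
    intro x y hxy
    exact (pushC_mk z d zd x y).1 (hle _ _ ((pushC_mk z t zt x y).2 hxy))
  · have h3 : pushC z z le_rfl = ⊥ := by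
      have := pushC_inf (z := z) (b := z) (d := z) le_rfl le_rfl (inf_idem z)
      rwa [inf_idem] at this
    rw [← h3]
    exact pushC_centralizes _ _ _ h2

/-! The algebra `A(β)` -/

def fstHom (A : Alg σ) (b : Congruence A) : UAHom (algOn A b) A where
  toFun p := p.1.1
  map_op _ _ := rfl

def sndHom (A : Alg σ) (b : Congruence A) : UAHom (algOn A b) A where
  toFun p := p.1.2
  map_op _ _ := rfl

theorem algOn_mem (V : Variety σ) (A : Alg σ) (hA : V.Mem A) (b : Congruence A) :
    V.Mem (algOn A b) := by
  apply V.closed_sub (V.closed_prod (fun _ : Bool => A) fun _ => hA)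
  refine ⟨⟨fun p i => cond i p.1.1 p.1.2, ?_⟩, ?_⟩
  · intro f a
    funext i
    cases i <;> rfl
  · intro p q h
    apply Subtype.ext
    exact Prod.ext (congrFun h true) (congrFun h false)

theorem main (V : Variety σ)
    (A : Alg σ) (hA : V.Mem A) (β δ θ α : Congruence A)
    (hpent : IsPentagon ⊥ β δ θ α)
    (hθθ : Centralizes θ θ δ) (hβθ : ¬ Centralizes β θ δ) :
    ∃ B : Alg σ, V.Mem B ∧ ∃ β' δ' θ' α' : Congruence B,
      IsPentagon ⊥ β' δ' θ' α' ∧ Centralizes α' α' β' ∧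
      Centralizes θ' θ' (⊥ : Congruence B) := by
  obtain ⟨hdt, hbt, -, -, -⟩ := hpent
  have triv : ∀ x y, β.rel x y → θ.rel x y → x = y := by
    intro x y h1 h2
    rw [← bot_rel (A := A), ← hbt, inf_rel]
    exact ⟨h1, h2⟩
  obtain ⟨p, q, r, s, hpr, hqs, hpq, hrs, hnrs⟩ : ∃ p q r s, β.rel p r ∧ β.rel q s ∧
      δ.rel p q ∧ θ.rel r s ∧ ¬ δ.rel r s := by
    simp only [Centralizes, not_forall] at hβθ
    obtain ⟨m, n, t, a, b, u, v, hab, huv, hp, hn⟩ := hβθ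
    refine ⟨_, _, _, _, eval_rel β _ _ ?_ t, eval_rel β _ _ ?_ t, hp, eval_rel θ _ _ ?_ t, hn⟩
    · rintro (i | i)
      exacts [hab i, β.iseqv.refl _]
    · rintro (i | i)
      exacts [hab i, β.iseqv.refl _]
    · rintro (i | i)
      exacts [θ.iseqv.refl _, huv i]
  let δ₁ := comapC (fstHom A β) δ
  let δ₂ := comapC (sndHom A β) δ
  let θ₁ := comapC (fstHom A β) θ
  let θ₂ := comapC (sndHom A β) θ
  have hδθ₁ : δ₁ ≤ θ₁ := fun _ _ h => hdt.le _ _ h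
  have hδθ₂ : δ₂ ≤ θ₂ := fun _ _ h => hdt.le _ _ h
  let D₁ := δ₁ ⊓ θ₂
  let D₂ := θ₁ ⊓ δ₂
  let α' := δ₁ ⊔ D₂
  let θ' := (θ₁ ⊓ θ₂) ⊓ α'
  let δ' := joinC D₁ D₂
  have hα'θ₁ : α' ≤ θ₁ := sup_le hδθ₁ inf_le_left
  have hD₁θ' : D₁ ≤ θ' := le_inf (inf_le_inf hδθ₁ le_rfl) (inf_le_left.trans le_sup_left)
  have hD₂θ' : D₂ ≤ θ' := le_inf (inf_le_inf le_rfl hδθ₂) le_sup_right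
  have hδ'θ' : δ' ≤ θ' := joinC_le hD₁θ' hD₂θ'
  have hbase : δ₁ ⊓ θ' = D₁ := by
    apply le_antisymm
    · exact le_inf inf_le_left (inf_le_right.trans (inf_le_left.trans inf_le_right))
    · exact le_inf inf_le_left hD₁θ'
  have hcent : Centralizes θ₁ θ₁ δ₁ := comap_centralizes _ hθθ
  -- in a `Θ`-class of a diagonal element, everything is diagonal
  have hdiag : ∀ P Q : (algOn A β).carrier, δ'.rel P Q →
      (P.1.1 = P.1.2 ↔ Q.1.1 = Q.1.2) ∧ (P.1.1 = P.1.2 → δ.rel P.1.1 Q.1.1) := by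
    have hΘ : ∀ P Q : (algOn A β).carrier, θ.rel P.1.1 Q.1.1 → θ.rel P.1.2 Q.1.2 →
        P.1.1 = P.1.2 → Q.1.1 = Q.1.2 := by
      intro P Q h1 h2 h
      apply triv _ _ Q.2
      rw [h] at h1
      exact θ.iseqv.trans (θ.iseqv.symm h1) h2
    intro P Q h
    change Relation.EqvGen _ P Q at h
    induction h with
    | rel P Q h =>
      have hPQ : θ'.rel P Q := h.elim (hD₁θ' _ _) (hD₂θ' _ _)
      have h12 := (inf_rel _ _ _ _).1 ((inf_rel _ _ _ _).1 hPQ).1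
      have e1 : θ.rel P.1.1 Q.1.1 := h12.1
      have e2 : θ.rel P.1.2 Q.1.2 := h12.2
      refine ⟨⟨hΘ P Q e1 e2, hΘ Q P (θ.iseqv.symm e1) (θ.iseqv.symm e2)⟩, fun hP => ?_⟩
      rcases h with h | h
      · exact ((inf_rel _ _ _ _).1 h).1
      · have h3 : δ.rel P.1.2 Q.1.2 := ((inf_rel _ _ _ _).1 h).2
        rwa [← hP, ← hΘ P Q e1 e2 hP] at h3
    | refl P => exact ⟨Iff.rfl, fun _ => δ.iseqv.refl _⟩
    | symm P Q _ ih => exact ⟨ih.1.symm, fun h => δ.iseqv.symm (ih.2 (ih.1.2 h))⟩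
    | trans P Q R _ _ ih1 ih2 =>
      exact ⟨ih1.1.trans ih2.1, fun h => δ.iseqv.trans (ih1.2 h) (ih2.2 (ih1.1.1 h))⟩
  have hlt : δ' < θ' := by
    refine lt_of_le_not_ge hδ'θ' fun hle => hnrs ?_
    let R : (algOn A β).carrier := ⟨(r, r), β.iseqv.refl r⟩
    let S : (algOn A β).carrier := ⟨(s, s), β.iseqv.refl s⟩
    let P : (algOn A β).carrier := ⟨(r, p), β.iseqv.symm hpr⟩
    let Q : (algOn A β).carrier := ⟨(s, q), β.iseqv.symm hqs⟩
    have h1 : α'.rel R P := (le_sup_left : δ₁ ≤ α') R P (δ.iseqv.refl r)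
    have h2 : α'.rel P Q := (le_sup_right : D₂ ≤ α') P Q ((inf_rel _ _ _ _).2 ⟨hrs, hpq⟩)
    have h3 : α'.rel Q S := (le_sup_left : δ₁ ≤ α') Q S (δ.iseqv.refl s)
    have h4 : θ'.rel R S := (inf_rel _ _ _ _).2 ⟨(inf_rel _ _ _ _).2 ⟨hrs, hrs⟩,
      α'.iseqv.trans h1 (α'.iseqv.trans h2 h3)⟩
    exact (hdiag R S (hle _ _ h4)).2 rfl
  refine reduce V (algOn A β) (algOn_mem V A hA β) D₁ δ₁ δ' θ' α'
    ⟨hlt, hbase, ?_, ?_, ?_⟩ (centralizes_mono hα'θ₁ hα'θ₁ hcent) ?_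
  · apply le_antisymm
    · exact (inf_le_inf le_rfl hδ'θ').trans hbase.le
    · exact le_inf inf_le_left (left_le_joinC _ _)
  · apply le_antisymm
    · exact sup_le le_sup_left (hδ'θ'.trans inf_le_right)
    · exact sup_le_sup le_rfl (right_le_joinC _ _)
  · apply le_antisymm
    · exact sup_le le_sup_left inf_le_right
    · exact sup_le_sup le_rfl hD₂θ'
  · intro m n t a b u v hab huv hp
    have hθ'θ₁ : θ' ≤ θ₁ := inf_le_right.trans hα'θ₁
    refine (inf_rel _ _ _ _).2 ⟨?_, ?_⟩
    · exact hcent m n t a b u v (fun i => hθ'θ₁ _ _ (hab i)) (fun i => hθ'θ₁ _ _ (huv i))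
        ((inf_rel _ _ _ _).1 hp).1
    · apply eval_rel θ₂
      rintro (i | i)
      · exact θ₂.iseqv.refl _
      · exact ((inf_rel _ _ _ _).1 ((inf_rel _ _ _ _).1 (huv i)).1).2

end BP

/-- **Better pentagons.** If a variety contains an algebra with a pentagon
`{0, β, δ, θ, α}` in its congruence lattice such that `C(θ,θ;δ)` holds and
`C(β,θ;δ)` fails, then the variety contains an algebra with a pentagon
`{0, β', δ', θ', α'}` satisfying `C(α',α';β')` and `C(θ',θ';0)`. -/
theorem better_pentagons {σ : Sig} (V : Variety σ)
    (A : Alg σ) (hA : V.Mem A) (β δ θ α : Congruence A)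
    (hpent : IsPentagon ⊥ β δ θ α)
    (hθθ : Centralizes θ θ δ) (hβθ : ¬ Centralizes β θ δ) :
    ∃ B : Alg σ, V.Mem B ∧ ∃ β' δ' θ' α' : Congruence B,
      IsPentagon ⊥ β' δ' θ' α' ∧ Centralizes α' α' β' ∧
      Centralizes θ' θ' (⊥ : Congruence B) := by
  exact BP.main V A hA β δ θ α hpent hθθ hβθ
end

section
/- Let V be an arbitrary variety. If the commutator is left distributive throughout V, i.e., [x + y, z] = [x,z] + [y,z] holds for all congruences x, y, z on every algebra in V, then the commutator is commutative throughout V, i.e., [x,y] = [y,x] for all congruences x, y on every algebra in V. -/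
namespace LD

variable {σ : Sig}

/-- The `S,T`-matrices, generated inductively. -/
inductive Mat {A : Alg σ} (S T : Congruence A) :
    A.carrier → A.carrier → A.carrier → A.carrier → Prop
  | left (x y) : S.rel x y → Mat S T x x y y
  | right (u v) : T.rel u v → Mat S T u v u v
  | op (f : σ.ops) (p q r s : Fin (σ.arity f) → A.carrier) :
      (∀ i, Mat S T (p i) (q i) (r i) (s i)) →
      Mat S T (A.interp f p) (A.interp f q) (A.interp f r) (A.interp f s)

/-- Renaming variables. -/
def ren {V W : Type} (e : V → W) : Trm σ V → Trm σ W
  | .var v => .var (e v)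
  | .op f ts => .op f fun i => ren e (ts i)

theorem eval_ren {A : Alg σ} {V W : Type} (e : V → W) (g : W → A.carrier) (t : Trm σ V) :
    A.evalTrm g (ren e t) = A.evalTrm (g ∘ e) t := by
  induction t with
  | var v => rfl
  | op f ts ih =>
    simp only [ren, Alg.evalTrm]
    congr 1
    funext i
    exact ih i

theorem mat_of_term {A : Alg σ} {S T : Congruence A} {I J : Type}
    (t : Trm σ (Sum I J)) (a b : I → A.carrier) (u v : J → A.carrier)
    (h : ∀ i, S.rel (a i) (b i)) (k : ∀ j, T.rel (u j) (v j)) :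
    Mat S T (A.evalTrm (Sum.elim a u) t) (A.evalTrm (Sum.elim a v) t)
      (A.evalTrm (Sum.elim b u) t) (A.evalTrm (Sum.elim b v) t) := by
  induction t with
  | var x =>
    cases x with
    | inl i => exact Mat.left _ _ (h i)
    | inr j => exact Mat.right _ _ (k j)
  | op f ts ih => exact Mat.op f _ _ _ _ ih

theorem term_of_mat {A : Alg σ} {S T : Congruence A} {p q r s : A.carrier}
    (h : Mat S T p q r s) :
    ∃ (I J : Type) (_ : Finite I) (_ : Finite J) (t : Trm σ (Sum I J))
      (a b : I → A.carrier) (u v : J → A.carrier),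
      (∀ i, S.rel (a i) (b i)) ∧ (∀ j, T.rel (u j) (v j)) ∧
      A.evalTrm (Sum.elim a u) t = p ∧ A.evalTrm (Sum.elim a v) t = q ∧
      A.evalTrm (Sum.elim b u) t = r ∧ A.evalTrm (Sum.elim b v) t = s := by
  induction h with
  | left x y h =>
    exact ⟨Unit, Empty, inferInstance, inferInstance, .var (.inl ()), fun _ => x, fun _ => y,
      fun e => e.elim, fun e => e.elim, fun _ => h, fun e => e.elim, rfl, rfl, rfl, rfl⟩
  | right x y h =>
    exact ⟨Empty, Unit, inferInstance, inferInstance, .var (.inr ()),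
      fun e => e.elim, fun e => e.elim, fun _ => x, fun _ => y, fun e => e.elim,
      fun _ => h, rfl, rfl, rfl, rfl⟩
  | op f p q r s _ ih =>
    choose I J hI hJ t a b u v h1 h2 h3 h4 h5 h6 using ih
    refine ⟨Σ i, I i, Σ i, J i, inferInstance, inferInstance,
      .op f fun i => ren (Sum.map (Sigma.mk i) (Sigma.mk i)) (t i),
      fun x => a x.1 x.2, fun x => b x.1 x.2, fun x => u x.1 x.2, fun x => v x.1 x.2,
      fun x => h1 _ _, fun x => h2 _ _, ?_, ?_, ?_, ?_⟩ <;>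
    · simp only [Alg.evalTrm, eval_ren, Sum.elim_comp_map]
      congr 1
      funext i
      first | exact h3 i | exact h4 i | exact h5 i | exact h6 i

theorem centralizes_iff {A : Alg σ} {S T δ : Congruence A} :
    Centralizes S T δ ↔ ∀ p q r s, Mat S T p q r s → δ.rel p q → δ.rel r s := by
  constructor
  · intro h p q r s hm hpq
    obtain ⟨I, J, hI, hJ, t, a, b, u, v, h1, h2, rfl, rfl, rfl, rfl⟩ := term_of_mat hm
    obtain ⟨m, ⟨e⟩⟩ := Finite.exists_equiv_fin I
    obtain ⟨n, ⟨e'⟩⟩ := Finite.exists_equiv_fin J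
    have key := h m n (ren (Sum.map e e') t) (a ∘ e.symm) (b ∘ e.symm) (u ∘ e'.symm)
      (v ∘ e'.symm) (fun i => h1 _) (fun j => h2 _)
    simp only [eval_ren, Sum.elim_comp_map, Function.comp_assoc, Equiv.symm_comp_self,
      Function.comp_id] at key
    exact key hpq
  · intro h m n t a b u v h1 h2 hpq
    exact h _ _ _ _ (mat_of_term t a b u v h1 h2) hpq

theorem Mat.rels {A : Alg σ} {S T : Congruence A} {p q r s : A.carrier}
    (h : Mat S T p q r s) : S.rel p r ∧ S.rel q s ∧ T.rel r s := by
  induction h with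
  | left x y h => exact ⟨h, h, T.iseqv.refl _⟩
  | right x y h => exact ⟨S.iseqv.refl _, S.iseqv.refl _, h⟩
  | op f p q r s _ ih =>
    exact ⟨S.compat _ _ _ fun i => (ih i).1, S.compat _ _ _ fun i => (ih i).2.1,
      T.compat _ _ _ fun i => (ih i).2.2⟩

theorem commC_centralizes {A : Alg σ} (S T : Congruence A) : Centralizes S T (commC S T) := by
  rw [centralizes_iff]
  intro p q r s hm h c hc
  exact centralizes_iff.1 hc p q r s hm (h c hc)

theorem commC_le {A : Alg σ} {S T δ : Congruence A} (h : Centralizes S T δ) :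
    ∀ a b, (commC S T).rel a b → δ.rel a b := fun _ _ hab => hab δ h

theorem commC_le_left {A : Alg σ} (S T : Congruence A) :
    ∀ a b, (commC S T).rel a b → S.rel a b := by
  apply commC_le
  rw [centralizes_iff]
  intro p q r s hm h
  exact S.iseqv.trans (S.iseqv.symm hm.rels.1) (S.iseqv.trans h hm.rels.2.1)

theorem commC_le_right {A : Alg σ} (S T : Congruence A) :
    ∀ a b, (commC S T).rel a b → T.rel a b := by
  apply commC_le
  rw [centralizes_iff]
  intro p q r s hm _
  exact hm.rels.2.2

/-- The congruence generated by a relation that is compatible in each coordinate. -/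
def genCong {A : Alg σ} (R : A.carrier → A.carrier → Prop)
    (hR : ∀ (f : σ.ops) (w : Fin (σ.arity f) → A.carrier) (i) (x y), R x y →
      R (A.interp f (Function.update w i x)) (A.interp f (Function.update w i y))) :
    Congruence A where
  rel := Relation.EqvGen R
  iseqv := Relation.EqvGen.is_equivalence R
  compat := by
    intro f a b h
    have one : ∀ (w : Fin (σ.arity f) → A.carrier) (i) (x y), Relation.EqvGen R x y →
        Relation.EqvGen R (A.interp f (Function.update w i x))
          (A.interp f (Function.update w i y)) := by
      intro w i x y hxy
      induction hxy with
      | rel x y h => exact .rel _ _ (hR f w i x y h)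
      | refl x => exact .refl _
      | symm x y _ ih => exact .symm _ _ ih
      | trans x y z _ _ ih1 ih2 => exact .trans _ _ _ ih1 ih2
    have key : ∀ s : Finset (Fin (σ.arity f)),
        Relation.EqvGen R (A.interp f a) (A.interp f (s.piecewise b a)) := by
      intro s
      induction s using Finset.induction_on with
      | empty => rw [Finset.piecewise_empty]; exact .refl _
      | insert i s hi ih =>
        refine .trans _ _ _ ih ?_
        rw [Finset.piecewise_insert]
        have := one (s.piecewise b a) i (a i) (b i) (h i)
        have e : Function.update (s.piecewise b a) i (a i) = s.piecewise b a := by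
          rw [Function.update_eq_self_iff]
          simp [hi]
        rwa [e] at this
    have := key Finset.univ
    rwa [Finset.piecewise_univ] at this

theorem sup_singleton {A : Alg σ} (x y : Congruence A) (q : A.carrier)
    (hx : ∀ w, x.rel q w → w = q) (hy : ∀ w, y.rel q w → w = q) :
    ∀ w, (x ⊔ y).rel q w → w = q := by
  let c : Congruence A := genCong (fun a b => x.rel a b ∨ y.rel a b) (by
    intro f w i a b h
    have aux : ∀ z : Congruence A, z.rel a b →
        z.rel (A.interp f (Function.update w i a)) (A.interp f (Function.update w i b)) := by
      intro z hz
      apply z.compat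
      intro j
      by_cases hj : j = i
      · subst hj; simpa using hz
      · simp only [Function.update_of_ne hj]; exact z.iseqv.refl _
    exact h.imp (aux x) (aux y))
  have hle : x ⊔ y ≤ c :=
    sup_le (fun a b h => .rel _ _ (Or.inl h)) (fun a b h => .rel _ _ (Or.inr h))
  have key : ∀ a b, c.rel a b → (a = q ↔ b = q) := by
    intro a b h
    induction h with
    | rel a b h =>
      constructor
      · rintro rfl
        exact h.elim (hx b) (hy b)
      · rintro rfl
        exact h.elim (fun h => hx a (x.iseqv.symm h)) (fun h => hy a (y.iseqv.symm h))
    | refl => rfl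
    | symm _ _ _ ih => exact ih.symm
    | trans _ _ _ _ _ ih1 ih2 => exact ih1.trans ih2
  intro w hw
  exact (key _ _ (hle _ _ hw)).1 rfl

/-- diagonal elements -/
def dg {A : Alg σ} (α : Congruence A) (x : A.carrier) : (algOn A α).carrier :=
  ⟨(x, x), α.iseqv.refl x⟩

theorem Mat.symm {A : Alg σ} {S T : Congruence A} {p q r s : A.carrier}
    (h : Mat S T p q r s) : Mat S T r s p q := by
  induction h with
  | left x y h => exact .left _ _ (S.iseqv.symm h)
  | right x y h => exact .right _ _ h
  | op f p q r s _ ih => exact .op f _ _ _ _ ih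

theorem delta_diag {A : Alg σ} {α β : Congruence A}
    (hc : ∀ p q r s, Mat β α p q r s → p = q → r = s)
    (X Y : (algOn A α).carrier) (h : (diagDelta A α β).rel X Y) :
    X.1.1 = X.1.2 ↔ Y.1.1 = Y.1.2 := by
  let c : Congruence (algOn A α) :=
    genCong (fun X Y => Mat β α X.1.1 X.1.2 Y.1.1 Y.1.2) (by
      intro f w i X Y h
      refine Mat.op f _ _ _ _ ?_
      intro j
      by_cases hj : j = i
      · subst hj; simpa using h
      · simp only [Function.update_of_ne hj]; exact Mat.right _ _ (w j).2)
  have hXY : c.rel X Y := h c (fun x z hxz => .rel _ _ (Mat.left _ _ hxz))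
  clear h
  induction hXY with
  | rel X Y h => exact ⟨hc _ _ _ _ h, hc _ _ _ _ h.symm⟩
  | refl => rfl
  | symm _ _ _ ih => exact ih.symm
  | trans _ _ _ _ _ ih1 ih2 => exact ih1.trans ih2

theorem mem_algOn (V : Variety σ) {A : Alg σ} (hA : V.Mem A) (α : Congruence A) :
    V.Mem (algOn A α) := by
  refine V.closed_sub (V.closed_prod (fun _ : Bool => A) fun _ => hA)
    ⟨⟨fun X b => cond b X.1.1 X.1.2, ?_⟩, ?_⟩
  · intro f a
    funext b
    cases b <;> rfl
  · intro X Y h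
    exact Subtype.ext (Prod.ext (congrFun h true) (congrFun h false))

theorem core (V : Variety σ) (hdist : CommLeftDistrib V) {A : Alg σ} (hA : V.Mem A)
    {α β : Congruence A} (hc : ∀ p q r s, Mat β α p q r s → p = q → r = s) :
    ∀ p q r s, Mat α β p q r s → p = q → r = s := by
  intro p q r s hm hpq
  have h1 : (eta1 A α) ≤ eta1 A α ⊔ eta2 A α := le_sup_left
  have h2 : (eta2 A α) ≤ eta1 A α ⊔ eta2 A α := le_sup_right
  have hM : Mat (eta1 A α ⊔ eta2 A α) (diagDelta A α β)
      (dg α p) (dg α q) (dg α r) (dg α s) := by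
    clear hpq
    induction hm with
    | left x y h =>
      refine .left _ _ ((eta1 A α ⊔ eta2 A α).iseqv.trans
        (h1 (dg α x) ⟨(x, y), h⟩ rfl) (h2 ⟨(x, y), h⟩ (dg α y) rfl))
    | right u v h => exact .right _ _ (fun c hc => hc u v h)
    | op f p q r s _ ih =>
      exact Mat.op (A := algOn A α) f (fun i => dg α (p i)) (fun i => dg α (q i))
        (fun i => dg α (r i)) (fun i => dg α (s i)) ih
  have hC := commC_centralizes (eta1 A α ⊔ eta2 A α) (diagDelta A α β)
  rw [hdist _ (mem_algOn V hA α)] at hC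
  have hrs := centralizes_iff.1 hC _ _ _ _ hM (by subst hpq; exact Congruence.iseqv _ |>.refl _)
  have := sup_singleton _ _ (dg α r) ?_ ?_ _ hrs
  · exact (congrArg (fun X => X.1.1) this).symm
  · intro w hw
    have e1 : r = w.1.1 := commC_le_left _ _ _ _ hw
    have e2 := (delta_diag hc _ _ (commC_le_right _ _ _ _ hw)).1 rfl
    exact Subtype.ext (Prod.ext e1.symm (e2.symm.trans e1.symm))
  · intro w hw
    have e1 : r = w.1.2 := commC_le_left _ _ _ _ hw
    have e2 := (delta_diag hc _ _ (commC_le_right _ _ _ _ hw)).1 rfl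
    exact Subtype.ext (Prod.ext (e2.trans e1.symm) e1.symm)

theorem out_rel {A : Alg σ} (δ : Congruence A) (x : A.carrier) :
    δ.rel (Quotient.mk δ.setoid x).out x :=
  Quotient.exact (s := δ.setoid) (Quotient.out_eq _)

theorem mk_interp {A : Alg σ} (δ : Congruence A) (f : σ.ops) (a : Fin (σ.arity f) → A.carrier) :
    Quotient.mk δ.setoid (A.interp f a) =
      (quotAlg A δ).interp f (fun i => Quotient.mk δ.setoid (a i)) :=
  Quotient.sound (s := δ.setoid)
    (δ.compat f _ _ fun i => δ.iseqv.symm (out_rel δ (a i)))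

/-- quotient congruence -/
def qc {A : Alg σ} (δ S : Congruence A) (h : ∀ a b, δ.rel a b → S.rel a b) :
    Congruence (quotAlg A δ) where
  rel X Y := S.rel (Quotient.out X) (Quotient.out Y)
  iseqv := ⟨fun _ => S.iseqv.refl _, S.iseqv.symm, S.iseqv.trans⟩
  compat f a b hab :=
    S.iseqv.trans (h _ _ (out_rel δ _)) (S.iseqv.trans (S.compat f _ _ hab)
      (S.iseqv.symm (h _ _ (out_rel δ _))))

theorem mat_down {A : Alg σ} {δ S T : Congruence A} (hS : ∀ a b, δ.rel a b → S.rel a b)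
    (hT : ∀ a b, δ.rel a b → T.rel a b) {p q r s : A.carrier} (h : Mat S T p q r s) :
    Mat (qc δ S hS) (qc δ T hT) (Quotient.mk δ.setoid p) (Quotient.mk δ.setoid q)
      (Quotient.mk δ.setoid r) (Quotient.mk δ.setoid s) := by
  induction h with
  | left x y h =>
    exact .left _ _ (S.iseqv.trans (hS _ _ (out_rel δ _)) (S.iseqv.trans h
      (S.iseqv.symm (hS _ _ (out_rel δ _)))))
  | right x y h =>
    exact .right _ _ (T.iseqv.trans (hT _ _ (out_rel δ _)) (T.iseqv.trans h
      (T.iseqv.symm (hT _ _ (out_rel δ _)))))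
  | op f p q r s _ ih =>
    rw [mk_interp, mk_interp, mk_interp, mk_interp]
    exact .op f _ _ _ _ ih

theorem mat_up {A : Alg σ} {δ S T : Congruence A} (hS : ∀ a b, δ.rel a b → S.rel a b)
    (hT : ∀ a b, δ.rel a b → T.rel a b) {P Q R U : (quotAlg A δ).carrier}
    (h : Mat (qc δ S hS) (qc δ T hT) P Q R U) :
    ∃ p q r s, Mat S T p q r s ∧ P = Quotient.mk δ.setoid p ∧ Q = Quotient.mk δ.setoid q ∧
      R = Quotient.mk δ.setoid r ∧ U = Quotient.mk δ.setoid s := by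
  induction h with
  | left x y h =>
    exact ⟨_, _, _, _, .left _ _ h, (Quotient.out_eq _).symm, (Quotient.out_eq _).symm,
      (Quotient.out_eq _).symm, (Quotient.out_eq _).symm⟩
  | right x y h =>
    exact ⟨_, _, _, _, .right _ _ h, (Quotient.out_eq _).symm, (Quotient.out_eq _).symm,
      (Quotient.out_eq _).symm, (Quotient.out_eq _).symm⟩
  | op f P Q R U _ ih =>
    choose p q r s hm h1 h2 h3 h4 using ih
    refine ⟨_, _, _, _, .op f p q r s hm, ?_, ?_, ?_, ?_⟩
    · rw [mk_interp, funext h1]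
    · rw [mk_interp, funext h2]
    · rw [mk_interp, funext h3]
    · rw [mk_interp, funext h4]

theorem half (V : Variety σ) (hdist : CommLeftDistrib V) {A : Alg σ} (hA : V.Mem A)
    (α β : Congruence A) : commC α β ≤ commC β α := by
  refine commC_le (centralizes_iff.2 ?_)
  have hβ := commC_le_left β α
  have hα := commC_le_right β α
  have hC := centralizes_iff.1 (commC_centralizes β α)
  generalize commC β α = δ at *
  have hB : V.Mem (quotAlg A δ) :=
    V.closed_hom hA ⟨⟨fun x => Quotient.mk δ.setoid x, mk_interp δ⟩, Quotient.mk_surjective⟩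
  have key := core V hdist hB (α := qc δ α hα) (β := qc δ β hβ) (by
    intro P Q R U hM hPQ
    obtain ⟨p, q, r, s, hm, rfl, rfl, rfl, rfl⟩ := mat_up hβ hα hM
    exact Quotient.sound (s := δ.setoid) (hC p q r s hm (Quotient.exact (s := δ.setoid) hPQ)))
  intro p q r s hm hpq
  exact Quotient.exact (s := δ.setoid)
    (key _ _ _ _ (mat_down hα hβ hm) (Quotient.sound (s := δ.setoid) hpq))

end LD

/-- If the commutator is left distributive throughout a variety `V`, then it
is commutative throughout `V`. -/
theorem left_distrib_implies_commutative {σ : Sig} (V : Variety σ)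
    (hdist : CommLeftDistrib V) : CommutativeCommutator V := by
  intro A hA x y
  exact le_antisymm (LD.half V hdist hA x y) (LD.half V hdist hA y x)
end

section
/- Let V be an arbitrary variety. If the commutator is right distributive throughout V, i.e., [x, y + z] = [x,y] + [x,z] holds for all congruences x, y, z on every algebra in V, then the commutator satisfies the following partial commutativity on comparable pairs: for all congruences x, y on any algebra in V, if y ≤ x then [x,y] ≤ [y,x]. -/
section Helpers

variable {σ : Sig}

/-- Substitution of terms for variables. -/
def tsubst {V W : Type} (s : V → Trm σ W) : Trm σ V → Trm σ W
  | .var v => s v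
  | .op f ts => .op f fun i => tsubst s (ts i)

theorem eval_tsubst (A : Alg σ) {V W : Type} (s : V → Trm σ W) (asg : W → A.carrier)
    (t : Trm σ V) :
    A.evalTrm asg (tsubst s t) = A.evalTrm (fun v => A.evalTrm asg (s v)) t := by
  induction t with
  | var v => rfl
  | op f ts ih =>
    simp only [tsubst, Alg.evalTrm]
    congr 1
    funext i
    exact ih i

theorem eval_hom {A B : Alg σ} (h : UAHom A B) {V : Type} (asg : V → A.carrier)
    (t : Trm σ V) :
    h.toFun (A.evalTrm asg t) = B.evalTrm (fun v => h.toFun (asg v)) t := by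
  induction t with
  | var v => rfl
  | op f ts ih =>
    simp only [Alg.evalTrm]
    rw [h.map_op]
    congr 1
    funext i
    exact ih i

theorem eval_rel {A : Alg σ} (c : Congruence A) {V : Type} (x y : V → A.carrier)
    (h : ∀ v, c.rel (x v) (y v)) (t : Trm σ V) :
    c.rel (A.evalTrm x t) (A.evalTrm y t) := by
  induction t with
  | var v => exact h v
  | op f ts ih => exact c.compat f _ _ ih

def fstHom (A : Alg σ) (α : Congruence A) : UAHom (algOn A α) A where
  toFun p := p.1.1
  map_op _ _ := rfl

def sndHom (A : Alg σ) (α : Congruence A) : UAHom (algOn A α) A where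
  toFun p := p.1.2
  map_op _ _ := rfl

/-- The equality congruence. -/
def eqC (A : Alg σ) : Congruence A where
  rel := Eq
  iseqv := ⟨fun _ => rfl, Eq.symm, Eq.trans⟩
  compat f _ _ h := congrArg (A.interp f) (funext h)

theorem centralizes_commC {A : Alg σ} (S T : Congruence A) :
    Centralizes S T (commC S T) := by
  intro m n t a b u v hab huv h δ hδ
  exact hδ m n t a b u v hab huv (h δ hδ)

theorem commC_le_of {A : Alg σ} {S T δ : Congruence A} (h : Centralizes S T δ) :
    commC S T ≤ δ := fun _ _ hab => hab δ h

theorem commC_le_right {A : Alg σ} (S T : Congruence A) : commC S T ≤ T := by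
  apply commC_le_of
  intro m n t a b u v hab huv _
  apply eval_rel
  rintro (i | j)
  · exact T.iseqv.refl _
  · exact huv j

theorem commC_le_left {A : Alg σ} (S T : Congruence A) : commC S T ≤ S := by
  apply commC_le_of
  intro m n t a b u v hab huv h
  have h1 : ∀ w : Fin n → A.carrier,
      S.rel (A.evalTrm (Sum.elim a w) t) (A.evalTrm (Sum.elim b w) t) := by
    intro w
    apply eval_rel
    rintro (i | j)
    · exact hab i
    · exact S.iseqv.refl _
  exact S.iseqv.trans (S.iseqv.symm (h1 u)) (S.iseqv.trans h (h1 v))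

theorem rel_of_eq {A : Alg σ} (c : Congruence A) {p q : A.carrier} (h : p = q) :
    c.rel p q := h ▸ c.iseqv.refl p

/-- Unary translations of an algebra. -/
inductive Tr (B : Alg σ) : (B.carrier → B.carrier) → Prop
  | id : Tr B (fun x => x)
  | step (g : B.carrier → B.carrier) (f : σ.ops) (i : Fin (σ.arity f))
      (c : Fin (σ.arity f) → B.carrier) : Tr B g →
      Tr B (fun x => g (B.interp f (Function.update c i x)))

theorem Tr.rep {B : Alg σ} {g : B.carrier → B.carrier} (hg : Tr B g) :
    ∃ (n : ℕ) (t : Trm σ (Sum (Fin 1) (Fin n))) (c : Fin n → B.carrier),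
      ∀ x, g x = B.evalTrm (Sum.elim (fun _ => x) c) t := by
  induction hg with
  | id => exact ⟨0, .var (.inl 0), fun i => i.elim0, fun x => rfl⟩
  | step g f i c _ ih =>
    obtain ⟨n, t, d, h⟩ := ih
    refine ⟨n + σ.arity f, tsubst (Sum.elim
      (fun _ => .op f fun j => if j = i then .var (.inl 0) else .var (.inr (Fin.natAdd n j)))
      (fun j => .var (.inr (Fin.castAdd _ j)))) t, Fin.append d c, fun x => ?_⟩
    refine (h _).trans ?_
    rw [eval_tsubst]
    congr 1
    funext v
    rcases v with v | j
    · simp only [Sum.elim_inl, Alg.evalTrm]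
      congr 1
      funext j
      by_cases hj : j = i
      · subst hj; simp [Alg.evalTrm]
      · simp [hj, Alg.evalTrm]
    · simp [Alg.evalTrm]

/-- The syntactic congruence of a subset. -/
def synC (B : Alg σ) (D : B.carrier → Prop) : Congruence B where
  rel p q := ∀ g, Tr B g → (D (g p) ↔ D (g q))
  iseqv := ⟨fun _ _ _ => Iff.rfl, fun h g hg => (h g hg).symm,
    fun h1 h2 g hg => (h1 g hg).trans (h2 g hg)⟩
  compat f a b h := by
    intro g hg
    have key : ∀ s : Finset (Fin (σ.arity f)),
        (D (g (B.interp f a)) ↔ D (g (B.interp f (s.piecewise b a)))) := by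
      intro s
      induction s using Finset.induction_on with
      | empty => simp
      | insert i s hi ih =>
        rw [ih, Finset.piecewise_insert]
        have := h i _ (Tr.step g f i (s.piecewise b a) hg)
        rw [← this]
        have e : Function.update (s.piecewise b a) i (a i) = s.piecewise b a := by
          rw [Function.update_eq_self_iff]
          simp [hi]
        rw [e]
    simpa using key Finset.univ

theorem algOn_mem (V : Variety σ) {A : Alg σ} (hA : V.Mem A) (α : Congruence A) :
    V.Mem (algOn A α) := by
  refine V.closed_sub (V.closed_prod (fun _ : Bool => A) fun _ => hA) ⟨⟨fun p b =>
    cond b p.1.1 p.1.2, ?_⟩, ?_⟩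
  · intro f a
    funext b
    cases b <;> rfl
  · intro p q h
    apply Subtype.ext
    exact Prod.ext (congrFun h true) (congrFun h false)

theorem core (V : Variety σ) (hdist : CommRightDistrib V) (A : Alg σ) (hA : V.Mem A)
    (α β : Congruence A) (hle : β ≤ α) (hC : Centralizes β α (eqC A)) :
    Centralizes α β (eqC A) := by
  let B := algOn A α
  let E : Congruence B := synC B (fun p => p.1.1 = p.1.2)
  have evB : ∀ {W : Type} (asg : W → B.carrier) (t : Trm σ W),
      (B.evalTrm asg t).1.1 = A.evalTrm (fun w => (asg w).1.1) t ∧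
      (B.evalTrm asg t).1.2 = A.evalTrm (fun w => (asg w).1.2) t := fun asg t =>
    ⟨eval_hom (fstHom A α) asg t, eval_hom (sndHom A α) asg t⟩
  have half : ∀ u v, β.rel u v → ∀ g, Tr B g →
      (g ⟨(u, u), α.iseqv.refl u⟩).1.1 = (g ⟨(u, u), α.iseqv.refl u⟩).1.2 →
      (g ⟨(v, v), α.iseqv.refl v⟩).1.1 = (g ⟨(v, v), α.iseqv.refl v⟩).1.2 := by
    intro u v huv g hg
    obtain ⟨n, t, c, h⟩ := hg.rep
    have e1 : ∀ w, (g ⟨(w, w), α.iseqv.refl w⟩).1.1 =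
        A.evalTrm (Sum.elim (fun _ => w) (fun j => (c j).1.1)) t := by
      intro w
      refine (congrArg (fun p : B.carrier => p.1.1) (h _)).trans ((evB _ _).1.trans ?_)
      congr 1
      funext z
      rcases z with z | z <;> rfl
    have e2 : ∀ w, (g ⟨(w, w), α.iseqv.refl w⟩).1.2 =
        A.evalTrm (Sum.elim (fun _ => w) (fun j => (c j).1.2)) t := by
      intro w
      refine (congrArg (fun p : B.carrier => p.1.2) (h _)).trans ((evB _ _).2.trans ?_)
      congr 1
      funext z
      rcases z with z | z <;> rfl
    intro hh
    exact (e1 v).trans ((hC 1 n t _ _ _ _ (fun _ => huv) (fun j => (c j).2)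
      ((e1 u).symm.trans (hh.trans (e2 u)))).trans (e2 v).symm)
  have hE : ∀ u v, β.rel u v →
      E.rel ⟨(u, u), α.iseqv.refl u⟩ ⟨(v, v), α.iseqv.refl v⟩ := fun u v huv g hg =>
    ⟨half u v huv g hg, half v u (β.iseqv.symm huv) g hg⟩
  have h0 : commC (eta2 A α) (eta1 A α) ≤ eqC B := by
    apply commC_le_of
    intro m n t a b u v hab huv h
    apply Subtype.ext
    apply Prod.ext
    · exact eval_rel (eta1 A α) (Sum.elim b u) (Sum.elim b v)
        (by rintro (i | j); exacts [rfl, huv j]) t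
    · have h1 : ∀ w : Fin n → B.carrier, (eta2 A α).rel
          (B.evalTrm (Sum.elim a w) t) (B.evalTrm (Sum.elim b w) t) := fun w =>
        eval_rel (eta2 A α) _ _ (by rintro (i | j); exacts [hab i, rfl]) t
      exact ((h1 u).symm.trans (congrArg (fun p : B.carrier => p.1.2) h)).trans (h1 v)
  have hcomm : commC (eta2 A α) (E ⊔ eta1 A α) ≤ E := by
    rw [hdist B (algOn_mem V hA α)]
    refine sup_le (commC_le_right _ _) (h0.trans ?_)
    intro p q h
    cases h
    exact E.iseqv.refl p
  intro m n t a b u v hab huv h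
  have hj : ∀ j, (E ⊔ eta1 A α).rel ⟨(u j, u j), α.iseqv.refl (u j)⟩
      ⟨(v j, u j), hle _ _ (β.iseqv.symm (huv j))⟩ := fun j =>
    (E ⊔ eta1 A α).iseqv.trans
      ((le_sup_left : E ≤ E ⊔ eta1 A α) _ _ (hE _ _ (huv j)))
      ((le_sup_right : eta1 A α ≤ E ⊔ eta1 A α)
        ⟨(v j, v j), α.iseqv.refl (v j)⟩ _ rfl)
  have main := centralizes_commC (eta2 A α) (E ⊔ eta1 A α) m n t
    (fun i => ⟨(a i, b i), hab i⟩) (fun i => ⟨(b i, b i), α.iseqv.refl _⟩) _ _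
    (fun _ => rfl) hj
  have el : ∀ (x : Fin m → B.carrier) (y : Fin n → B.carrier),
      (B.evalTrm (Sum.elim x y) t).1.1 =
        A.evalTrm (Sum.elim (fun i => (x i).1.1) (fun j => (y j).1.1)) t := by
    intro x y
    refine (evB _ _).1.trans ?_
    congr 1
    funext z
    rcases z with z | z <;> rfl
  have er : ∀ (x : Fin m → B.carrier) (y : Fin n → B.carrier),
      (B.evalTrm (Sum.elim x y) t).1.2 =
        A.evalTrm (Sum.elim (fun i => (x i).1.2) (fun j => (y j).1.2)) t := by
    intro x y
    refine (evB _ _).2.trans ?_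
    congr 1
    funext z
    rcases z with z | z <;> rfl
  let X : Fin m → B.carrier := fun i => ⟨(a i, b i), hab i⟩
  let Y : Fin m → B.carrier := fun i => ⟨(b i, b i), α.iseqv.refl _⟩
  let U : Fin n → B.carrier := fun j => ⟨(u j, u j), α.iseqv.refl (u j)⟩
  let W : Fin n → B.carrier := fun j => ⟨(v j, u j), hle _ _ (β.iseqv.symm (huv j))⟩
  have hXU : B.evalTrm (Sum.elim X U) t = B.evalTrm (Sum.elim X W) t :=
    Subtype.ext (Prod.ext ((el X U).trans (Eq.trans h (el X W).symm))
      ((er X U).trans (er X W).symm))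
  have main2 := hcomm _ _ (main (rel_of_eq _ hXU))
  have main3 := (main2 _ Tr.id).1 ((el Y U).trans (er Y U).symm)
  exact ((el Y W).symm.trans (Eq.trans main3 (er Y W))).symm

/-- Pushforward of a congruence above `δ` to the quotient. -/
noncomputable def quotC {A : Alg σ} (δ c : Congruence A) (h : δ ≤ c) :
    Congruence (quotAlg A δ) where
  rel p q := c.rel (Quotient.out (s := δ.setoid) p) (Quotient.out (s := δ.setoid) q)
  iseqv := ⟨fun _ => c.iseqv.refl _, fun h => c.iseqv.symm h,
    fun h1 h2 => c.iseqv.trans h1 h2⟩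
  compat f a b hab := by
    have k : ∀ x, c.rel (Quotient.out (Quotient.mk δ.setoid x)) x := fun x =>
      h _ _ (Quotient.exact (Quotient.out_eq (Quotient.mk δ.setoid x)))
    exact c.iseqv.trans (k _) (c.iseqv.trans (c.compat f _ _ hab) (c.iseqv.symm (k _)))

noncomputable def quotHom {A : Alg σ} (δ : Congruence A) : UAHom A (quotAlg A δ) where
  toFun := Quotient.mk δ.setoid
  map_op f a := Quotient.sound (s := δ.setoid) (δ.compat f _ _ fun i =>
    δ.iseqv.symm (Quotient.exact (Quotient.out_eq (Quotient.mk δ.setoid (a i)))))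

theorem quot_eval {A : Alg σ} (δ : Congruence A) {m n : ℕ}
    (t : Trm σ (Sum (Fin m) (Fin n))) (a : Fin m → A.carrier) (u : Fin n → A.carrier) :
    (quotAlg A δ).evalTrm (Sum.elim (fun i => (quotHom δ).toFun (a i))
      (fun j => (quotHom δ).toFun (u j))) t =
      (quotHom δ).toFun (A.evalTrm (Sum.elim a u) t) := by
  rw [eval_hom]
  congr 1
  funext z
  rcases z with z | z <;> rfl

theorem quot_cent {A : Alg σ} (δ S T : Congruence A) (hS : δ ≤ S) (hT : δ ≤ T) :
    Centralizes (quotC δ S hS) (quotC δ T hT) (eqC _) ↔ Centralizes S T δ := by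
  have k : ∀ x, δ.rel (Quotient.out (Quotient.mk δ.setoid x)) x := fun x =>
    Quotient.exact (Quotient.out_eq (Quotient.mk δ.setoid x))
  constructor
  · intro H m n t a b u v hab huv h
    have := H m n t (fun i => (quotHom δ).toFun (a i)) (fun i => (quotHom δ).toFun (b i))
      (fun i => (quotHom δ).toFun (u i)) (fun i => (quotHom δ).toFun (v i))
      (fun i => S.iseqv.trans (hS _ _ (k _)) (S.iseqv.trans (hab i)
        (S.iseqv.symm (hS _ _ (k _)))))
      (fun i => T.iseqv.trans (hT _ _ (k _)) (T.iseqv.trans (huv i)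
        (T.iseqv.symm (hT _ _ (k _)))))
    rw [quot_eval, quot_eval, quot_eval, quot_eval] at this
    exact Quotient.exact (this (Quotient.sound (s := δ.setoid) h))
  · intro H m n t a b u v hab huv
    have o : ∀ {l : ℕ} (w : Fin l → (quotAlg A δ).carrier),
        ∃ w' : Fin l → A.carrier, w' = (fun i => Quotient.out (s := δ.setoid) (w i)) ∧
          w = fun i => (quotHom δ).toFun (w' i) := fun w =>
      ⟨_, rfl, funext fun i => (Quotient.out_eq (s := δ.setoid) (w i)).symm⟩
    obtain ⟨a', ha, ha'⟩ := o a
    obtain ⟨b', hb, hb'⟩ := o b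
    obtain ⟨u', hu, hu'⟩ := o u
    obtain ⟨v', hv, hv'⟩ := o v
    have hab' : ∀ i, S.rel (a' i) (b' i) := by rw [ha, hb]; exact hab
    have huv' : ∀ i, T.rel (u' i) (v' i) := by rw [hu, hv]; exact huv
    rw [ha', hb', hu', hv', quot_eval, quot_eval, quot_eval, quot_eval]
    intro h
    exact Quotient.sound (s := δ.setoid)
      (H m n t a' b' u' v' hab' huv' (Quotient.exact h))

end Helpers

/-- If the commutator is right distributive throughout a variety `V`, then the
commutator satisfies partial commutativity on comparable pairs of congruences:
`y ≤ x` implies `[x,y] ≤ [y,x]`. -/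
theorem right_distrib_implies_partial_commutativity {σ : Sig} (V : Variety σ)
    (hdist : CommRightDistrib V) :
    ∀ A : Alg σ, V.Mem A → ∀ x y : Congruence A, y ≤ x →
      commC x y ≤ commC y x := by
  intro A hA x y hyx
  have hy : commC y x ≤ y := commC_le_left y x
  have hx : commC y x ≤ x := hy.trans hyx
  apply commC_le_of
  rw [← quot_cent _ _ _ hx hy]
  apply core V hdist
  · exact V.closed_hom hA ⟨quotHom _, fun q => Quotient.exists_rep q⟩
  · intro p q h
    exact hyx _ _ h
  · rw [quot_cent]
    exact centralizes_commC y x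
end

section
/- The following are equivalent for a variety V: (1) V has a weak difference term; (2) whenever A ∈ V and α ∈ Con(A) is abelian, the interval I[0,α] of Con(A) consists of pairwise permuting equivalence relations; (3) whenever A ∈ V and α ∈ Con(A) is abelian, the interval I[0,α] is a modular lattice; (4) whenever A ∈ V and α ∈ Con(A) is abelian, there is no pentagon sublattice {0, β, δ, θ, α} of Con(A) with top α and bottom 0; (5) whenever A ∈ V, there is no pentagon sublattice {0, β, δ, θ, α} of Con(A) with top α and bottom 0 such that [α,α] = 0 and C(θ,α;δ) hold. -/
namespace WD

variable {σ : Sig}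

/-! ### Terms -/

/-- Substitution. -/
def tb {V W : Type} (g : V → Trm σ W) : Trm σ V → Trm σ W
  | .var v => g v
  | .op f ts => .op f fun i => tb g (ts i)

/-- Renaming of variables. -/
def tm {V W : Type} (g : V → W) (t : Trm σ V) : Trm σ W := tb (fun v => .var (g v)) t

theorem eval_tb {V W : Type} (A : Alg σ) (g : V → Trm σ W) (asg : W → A.carrier) (t : Trm σ V) :
    A.evalTrm asg (tb g t) = A.evalTrm (fun v => A.evalTrm asg (g v)) t := by
  induction t with
  | var v => rfl
  | op f ts ih => simp only [tb, Alg.evalTrm, ih]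

theorem eval_tm {V W : Type} (A : Alg σ) (g : V → W) (asg : W → A.carrier) (t : Trm σ V) :
    A.evalTrm asg (tm g t) = A.evalTrm (fun v => asg (g v)) t := by
  rw [tm, eval_tb]; rfl

theorem tb_tb {U V W : Type} (g : U → Trm σ V) (h : V → Trm σ W) (t : Trm σ U) :
    tb h (tb g t) = tb (fun u => tb h (g u)) t := by
  induction t with
  | var v => rfl
  | op f ts ih => simp only [tb, ih]

theorem tm_tm {U V W : Type} (g : U → V) (h : V → W) (t : Trm σ U) :
    tm h (tm g t) = tm (fun u => h (g u)) t := by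
  simp only [tm, tb_tb, tb]

theorem tm_id {V : Type} (t : Trm σ V) : tm (fun v => v) t = t := by
  induction t with
  | var v => rfl
  | op f ts ih => exact congrArg (Trm.op f) (funext ih)

theorem tm_id' {V : Type} {g : V → V} (hg : ∀ v, g v = v) (t : Trm σ V) : tm g t = t := by
  have : g = fun v => v := funext hg
  rw [this, tm_id]

/-- Every term uses only finitely many variables. -/
theorem finite_support {V : Type} (t : Trm σ V) :
    ∃ (n : ℕ) (e : Fin n → V) (t' : Trm σ (Fin n)), t = tm e t' := by
  induction t with
  | var v => exact ⟨1, fun _ => v, .var 0, rfl⟩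
  | op f ts ih =>
    choose n e t' h using ih
    let q := Fintype.equivFin (Σ i, Fin (n i))
    refine ⟨_, fun k => e (q.symm k).1 (q.symm k).2, .op f fun i => tm (fun j => q ⟨i, j⟩) (t' i), ?_⟩
    change _ = Trm.op f fun i => tm _ (tm _ (t' i))
    congr 1; funext i
    rw [tm_tm]
    have e1 : (fun u => e (q.symm (q ⟨i, u⟩)).1 (q.symm (q ⟨i, u⟩)).2) = e i := by
      funext u
      rw [Equiv.symm_apply_apply q ⟨i, u⟩]
    rw [e1]
    exact h i

/-! ### Hybrid argument -/

theorem hybrid {n : ℕ} {X Y : Type} (R : Y → Y → Prop) (G : (Fin n → X) → Y) (a b : Fin n → X)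
    (hr : R (G a) (G a)) (ht : ∀ x y z, R x y → R y z → R x z)
    (h : ∀ i (c : Fin n → X), (∀ j, c j = a j ∨ c j = b j) →
      R (G (Function.update c i (a i))) (G (Function.update c i (b i)))) : R (G a) (G b) := by
  classical
  have key : ∀ s : Finset (Fin n), R (G a) (G (s.piecewise b a)) := by
    intro s
    induction s using Finset.induction_on with
    | empty => simpa using hr
    | insert i s hi ih =>
      refine ht _ _ _ ih ?_
      have := h i (s.piecewise b a) (fun j => by
        by_cases hj : j ∈ s <;> simp [hj])
      rw [Finset.piecewise_insert]
      have e : Function.update (s.piecewise b a) i (a i) = s.piecewise b a := by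
        apply Function.update_eq_self_iff.2
        simp [hi]
      rwa [e] at this
  simpa using key Finset.univ

/-! ### Congruence basics -/

variable {A : Alg σ}

theorem cong_term {V : Type} (c : Congruence A) (t : Trm σ V) (a b : V → A.carrier)
    (h : ∀ v, c.rel (a v) (b v)) : c.rel (A.evalTrm a t) (A.evalTrm b t) := by
  induction t with
  | var v => exact h v
  | op f ts ih => exact c.compat f _ _ ih

/-- Build a congruence from closure under basic translations. -/
def mkCong (r : A.carrier → A.carrier → Prop) (he : Equivalence r)
    (h : ∀ (f : σ.ops) (e : Fin (σ.arity f) → A.carrier) (i : Fin (σ.arity f)) (x y : A.carrier),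
      r x y → r (A.interp f (Function.update e i x)) (A.interp f (Function.update e i y))) :
    Congruence A where
  rel := r
  iseqv := he
  compat f a b hab := hybrid r (A.interp f) a b (he.refl _) (fun _ _ _ => he.trans)
    fun i c _ => h f c i _ _ (hab i)

/-- Equality congruence. -/
def eqC (A : Alg σ) : Congruence A where
  rel a b := a = b
  iseqv := ⟨fun _ => rfl, Eq.symm, Eq.trans⟩
  compat f a b h := congrArg _ (funext h)

theorem bot_eq : (⊥ : Congruence A) = eqC A := by
  apply le_antisymm bot_le
  intro a b h
  cases (h : a = b)
  exact (⊥ : Congruence A).iseqv.refl a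

theorem bot_rel {a b : A.carrier} : (⊥ : Congruence A).rel a b ↔ a = b := by
  rw [bot_eq]; rfl

theorem inf_rel {c d : Congruence A} {a b : A.carrier} :
    (c ⊓ d).rel a b ↔ c.rel a b ∧ d.rel a b := by
  constructor
  · intro h
    exact ⟨(inf_le_left : c ⊓ d ≤ c) a b h, (inf_le_right : c ⊓ d ≤ d) a b h⟩
  · rintro ⟨h1, h2⟩
    let e : Congruence A :=
      { rel := fun a b => c.rel a b ∧ d.rel a b
        iseqv := ⟨fun a => ⟨c.iseqv.refl a, d.iseqv.refl a⟩,
          fun h => ⟨c.iseqv.symm h.1, d.iseqv.symm h.2⟩,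
          fun h k => ⟨c.iseqv.trans h.1 k.1, d.iseqv.trans h.2 k.2⟩⟩
        compat := fun f a b h => ⟨c.compat f a b fun i => (h i).1, d.compat f a b fun i => (h i).2⟩ }
    have : e ≤ c ⊓ d := le_inf (fun a b h => h.1) (fun a b h => h.2)
    exact this a b ⟨h1, h2⟩

theorem abelian_iff {α : Congruence A} : IsAbelianCong α ↔ Centralizes α α ⊥ := by
  constructor
  · intro h
    rw [← h]
    intro m n t a b u v hab huv hp δ hδ
    exact hδ m n t a b u v hab huv (hp δ hδ)
  · intro h
    apply le_antisymm _ bot_le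
    intro a b hab
    exact hab ⊥ h

theorem bot_abelian : IsAbelianCong (⊥ : Congruence A) := by
  rw [abelian_iff]
  intro m n t a b u v hab huv hp
  have : a = b := funext fun i => bot_rel.1 (hab i)
  rwa [← this]

/-- Term condition with arbitrary variable types. -/
theorem centralizes_gen {S T δ : Congruence A} (h : Centralizes S T δ) {P Q : Type}
    (t : Trm σ (P ⊕ Q)) (a b : P → A.carrier) (u v : Q → A.carrier)
    (hab : ∀ i, S.rel (a i) (b i)) (huv : ∀ j, T.rel (u j) (v j))
    (hp : δ.rel (A.evalTrm (Sum.elim a u) t) (A.evalTrm (Sum.elim a v) t)) :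
    δ.rel (A.evalTrm (Sum.elim b u) t) (A.evalTrm (Sum.elim b v) t) := by
  obtain ⟨n, e, t, rfl⟩ := finite_support t
  let g : Fin n → Fin n ⊕ Fin n := fun k => Sum.elim (fun _ => .inl k) (fun _ => .inr k) (e k)
  let L : (P → A.carrier) → Fin n → A.carrier := fun a k => Sum.elim a u (e k)
  let R : (Q → A.carrier) → Fin n → A.carrier := fun u k => Sum.elim a u (e k)
  have key : ∀ (x : P → A.carrier) (y : Q → A.carrier),
      A.evalTrm (Sum.elim (L x) (R y)) (tm g t) = A.evalTrm (Sum.elim x y) (tm e t) := by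
    intro x y
    rw [eval_tm, eval_tm]
    congr 1; funext k
    simp only [g, L, R]
    cases hk : e k <;> simp [hk]
  have := h n n (tm g t) (L a) (L b) (R u) (R v) ?_ ?_ ?_
  · rwa [key, key] at this
  · intro k
    simp only [L]
    cases e k
    · exact hab _
    · exact S.iseqv.refl _
  · intro k
    simp only [R]
    cases e k
    · exact T.iseqv.refl _
    · exact huv _
  · rwa [key, key]

/-! ### Quotients -/

theorem mk_out (c : Congruence A) (a : A.carrier) :
    c.rel (Quotient.mk c.setoid a).out a := Quotient.exact (Quotient.out_eq (Quotient.mk c.setoid a))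

/-- The quotient map, valued in the carrier of the quotient algebra. -/
def qm (c : Congruence A) (a : A.carrier) : (quotAlg A c).carrier := Quotient.mk c.setoid a

/-- Choice of representative. -/
noncomputable def qo (c : Congruence A) (q : (quotAlg A c).carrier) : A.carrier :=
  Quotient.out (s := c.setoid) q

theorem qm_qo (c : Congruence A) (q : (quotAlg A c).carrier) : qm c (qo c q) = q :=
  Quotient.out_eq (s := c.setoid) q

theorem qo_qm (c : Congruence A) (a : A.carrier) : c.rel (qo c (qm c a)) a := mk_out c a

theorem qm_eq {c : Congruence A} {a b : A.carrier} : qm c a = qm c b ↔ c.rel a b :=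
  ⟨fun h => Quotient.exact h, fun h => Quotient.sound (s := c.setoid) h⟩

theorem quot_interp (c : Congruence A) (f : σ.ops) (a : Fin (σ.arity f) → A.carrier) :
    (quotAlg A c).interp f (fun i => qm c (a i)) = qm c (A.interp f a) :=
  qm_eq.2 (c.compat f _ _ fun i => qo_qm c (a i))

theorem quot_eval (c : Congruence A) {V : Type} (t : Trm σ V) (a : V → A.carrier) :
    (quotAlg A c).evalTrm (fun v => qm c (a v)) t = qm c (A.evalTrm a t) := by
  induction t with
  | var v => rfl
  | op f ts ih =>
    simp only [Alg.evalTrm, ih]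
    exact quot_interp c f _

theorem quot_eval' (c : Congruence A) {V : Type} (t : Trm σ V) (a : V → (quotAlg A c).carrier) :
    (quotAlg A c).evalTrm a t = qm c (A.evalTrm (fun v => qo c (a v)) t) := by
  rw [← quot_eval]
  congr 1; funext v; exact (qm_qo c (a v)).symm

/-- Push a congruence above `z` to the quotient by `z`. -/
def push (z c : Congruence A) (h : z ≤ c) : Congruence (quotAlg A z) where
  rel p q := c.rel (qo z p) (qo z q)
  iseqv := ⟨fun _ => c.iseqv.refl _, c.iseqv.symm, c.iseqv.trans⟩
  compat f a b hab := c.iseqv.trans (h _ _ (qo_qm z _))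
    (c.iseqv.trans (c.compat f _ _ hab) (c.iseqv.symm (h _ _ (qo_qm z _))))

theorem push_rel {z c : Congruence A} {h : z ≤ c} {a b : A.carrier} :
    (push z c h).rel (qm z a) (qm z b) ↔ c.rel a b := by
  constructor
  · intro k
    exact c.iseqv.trans (c.iseqv.symm (h _ _ (qo_qm z a))) (c.iseqv.trans k (h _ _ (qo_qm z b)))
  · intro k
    exact c.iseqv.trans (h _ _ (qo_qm z a)) (c.iseqv.trans k (c.iseqv.symm (h _ _ (qo_qm z b))))

/-- Pull a congruence of the quotient back. -/
def pull (z : Congruence A) (c : Congruence (quotAlg A z)) : Congruence A where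
  rel a b := c.rel (qm z a) (qm z b)
  iseqv := ⟨fun _ => c.iseqv.refl _, c.iseqv.symm, c.iseqv.trans⟩
  compat f a b hab := by
    rw [← quot_interp, ← quot_interp]
    exact c.compat f _ _ hab

theorem push_bot {z : Congruence A} : push z z le_rfl = ⊥ := by
  rw [bot_eq]
  apply Congruence.ext'
  funext p q
  apply propext
  constructor
  · intro h
    rw [← qm_qo z p, ← qm_qo z q]
    exact qm_eq.2 h
  · intro h
    cases (h : p = q)
    exact z.iseqv.refl _

theorem push_centralizes {z S T δ : Congruence A} {hS : z ≤ S} {hT : z ≤ T} {hδ : z ≤ δ}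
    (h : Centralizes S T δ) : Centralizes (push z S hS) (push z T hT) (push z δ hδ) := by
  intro m n t a b u v hab huv hp
  have key : ∀ (x : Fin m → (quotAlg A z).carrier) (y : Fin n → (quotAlg A z).carrier),
      (quotAlg A z).evalTrm (Sum.elim x y) t =
        qm z (A.evalTrm (Sum.elim (fun i => qo z (x i)) (fun i => qo z (y i))) t) := by
    intro x y
    rw [quot_eval']
    congr 2; funext k
    cases k <;> rfl
  rw [key, key, push_rel] at hp ⊢
  exact h m n t _ _ _ _ hab huv hp

/-! ### Term algebra and membership in the variety -/

/-- The term algebra. -/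
abbrev TA (σ : Sig) (X : Type) : Alg σ where
  carrier := Trm σ X
  interp f ts := .op f ts

theorem TA_eval {X V : Type} (g : V → Trm σ X) (t : Trm σ V) : (TA σ X).evalTrm g t = tb g t := by
  induction t with
  | var v => rfl
  | op f ts ih => simp only [Alg.evalTrm, tb, ih]

/-- Identities of the variety. -/
def VEq (V : Variety σ) {X : Type} (s t : Trm σ X) : Prop :=
  ∀ B : Alg σ, V.Mem B → ∀ asg : X → B.carrier, B.evalTrm asg s = B.evalTrm asg t

theorem prod_eval {I : Type} (F : I → Alg σ) {X : Type} (asg : X → (prodAlg F).carrier)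
    (t : Trm σ X) (i : I) : (prodAlg F).evalTrm asg t i = (F i).evalTrm (fun x => asg x i) t := by
  induction t with
  | var v => rfl
  | op f ts ih =>
    simp only [Alg.evalTrm, prodAlg] at ih ⊢
    simp only [ih]

theorem quot_mem (V : Variety σ) {X : Type} (c : Congruence (TA σ X))
    (hc : ∀ s t : Trm σ X, VEq V s t → c.rel s t) : V.Mem (quotAlg (TA σ X) c) := by
  classical
  let I := {p : Trm σ X × Trm σ X // ¬ VEq V p.1 p.2}
  have hI : ∀ i : I, ∃ (B : Alg σ) (asg : X → B.carrier), V.Mem B ∧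
      B.evalTrm asg i.1.1 ≠ B.evalTrm asg i.1.2 := by
    intro i
    have := i.2
    simp only [VEq, not_forall] at this
    obtain ⟨B, hB, asg, h⟩ := this
    exact ⟨B, asg, hB, h⟩
  choose B asg hB hne using hI
  let gen : X → (prodAlg B).carrier := fun x i => asg i x
  let S : Alg σ :=
    { carrier := {f : (prodAlg B).carrier // ∃ s : Trm σ X, f = (prodAlg B).evalTrm gen s}
      interp := fun f a => ⟨(prodAlg B).interp f fun i => (a i).1,
        .op f fun i => (a i).2.choose, by
          simp only [Alg.evalTrm]
          congr 1; funext i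
          exact (a i).2.choose_spec⟩ }
  have hS : V.Mem S := V.closed_sub (V.closed_prod B hB)
    ⟨⟨fun f => f.1, fun f a => rfl⟩, fun a b h => Subtype.ext h⟩
  have inj : ∀ s t : Trm σ X, (prodAlg B).evalTrm gen s = (prodAlg B).evalTrm gen t → VEq V s t := by
    intro s t h
    by_contra hn
    apply hne ⟨(s, t), hn⟩
    have := congrFun h ⟨(s, t), hn⟩
    rwa [prod_eval, prod_eval] at this
  refine V.closed_hom hS ⟨⟨fun f => qm c f.2.choose, ?_⟩, ?_⟩
  · intro f a
    have hq := quot_interp c f (fun i => ((a i).2.choose : Trm σ X))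
    refine Eq.trans ?_ hq.symm
    refine qm_eq.2 (hc _ _ (inj _ _ ?_))
    rw [← (S.interp f a).2.choose_spec]
    change _ = (prodAlg B).evalTrm gen (Trm.op f fun i => (a i).2.choose)
    simp only [Alg.evalTrm]
    change (prodAlg B).interp f (fun i => (a i).1) = _
    congr 1; funext i
    exact (a i).2.choose_spec
  · intro q
    refine ⟨⟨(prodAlg B).evalTrm gen (qo c q), qo c q, rfl⟩, ?_⟩
    refine Eq.trans (qm_eq.2 (hc _ _ (inj _ _ ?_))) (qm_qo c q)
    exact (Exists.choose_spec (p := fun s : Trm σ X =>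
      (prodAlg B).evalTrm gen (qo c q) = (prodAlg B).evalTrm gen s) _).symm


/-! ### The parallelogram relation -/

/-- Assignment on `Option W`. -/
def oe {X W : Type} (a : X) (c : W → X) : Option W → X := fun o => o.elim a c

/-- The two-term-condition relation. -/
def Rho (α : Congruence A) (a b a' b' : A.carrier) : Prop :=
  α.rel a b ∧ α.rel a a' ∧ α.rel a b' ∧
    ∀ (W : Type) (t : Trm σ (Option W)) (c d : W → A.carrier), (∀ w, α.rel (c w) (d w)) →
      (A.evalTrm (oe a c) t = A.evalTrm (oe b d) t ↔ A.evalTrm (oe a' c) t = A.evalTrm (oe b' d) t)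

section rho

variable {α : Congruence A}

theorem Rho.refl {a b : A.carrier} (h : α.rel a b) : Rho α a b a b :=
  ⟨h, α.iseqv.refl a, h, fun _ _ _ _ _ => Iff.rfl⟩

theorem Rho.symm {a b a' b' : A.carrier} (h : Rho α a b a' b') : Rho α a' b' a b := by
  obtain ⟨h1, h2, h3, h4⟩ := h
  have h2' := α.iseqv.symm h2
  exact ⟨α.iseqv.trans h2' h3, h2', α.iseqv.trans h2' h1, fun W t c d hcd => (h4 W t c d hcd).symm⟩

theorem Rho.trans {a b a' b' a'' b'' : A.carrier} (h : Rho α a b a' b') (k : Rho α a' b' a'' b'') :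
    Rho α a b a'' b'' := by
  obtain ⟨h1, h2, h3, h4⟩ := h
  obtain ⟨k1, k2, k3, k4⟩ := k
  exact ⟨h1, α.iseqv.trans h2 k2, α.iseqv.trans h2 k3,
    fun W t c d hcd => (h4 W t c d hcd).trans (k4 W t c d hcd)⟩

theorem Rho.swap {a b a' b' : A.carrier} (h : Rho α a b a' b') : Rho α b a b' a' := by
  obtain ⟨h1, h2, h3, h4⟩ := h
  have h1' := α.iseqv.symm h1
  refine ⟨h1', α.iseqv.trans h1' h3, α.iseqv.trans h1' h2, fun W t c d hcd => ?_⟩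
  rw [eq_comm, h4 W t d c (fun w => α.iseqv.symm (hcd w)), eq_comm]

theorem Rho.eq_of {a c d : A.carrier} (h : Rho α a a c d) : c = d :=
  (h.2.2.2 Empty (.var none) Empty.elim Empty.elim (fun w => w.elim)).1 rfl

theorem tc_diag (hα : IsAbelianCong α) {W : Type} (t : Trm σ (Option W)) {a b : A.carrier}
    {c d : W → A.carrier} (hab : α.rel a b) (hcd : ∀ w, α.rel (c w) (d w))
    (h : A.evalTrm (oe a c) t = A.evalTrm (oe a d) t) :
    A.evalTrm (oe b c) t = A.evalTrm (oe b d) t := by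
  have key : ∀ (a : A.carrier) (c : W → A.carrier),
      A.evalTrm (Sum.elim (fun _ : Unit => a) c)
        (tm (fun o : Option W => o.elim (Sum.inl ()) Sum.inr) t) = A.evalTrm (oe a c) t := by
    intro a c
    rw [eval_tm]; congr 1; funext o; cases o <;> rfl
  have := centralizes_gen (abelian_iff.1 hα)
    (tm (fun o : Option W => o.elim (Sum.inl ()) Sum.inr) t)
    (fun _ : Unit => a) (fun _ => b) c d (fun _ => hab) hcd (bot_rel.2 (by rw [key, key, h]))
  rwa [key, key, bot_rel] at this

theorem tc_side (hα : IsAbelianCong α) {W : Type} (t : Trm σ (Option W)) {a b : A.carrier}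
    {c d : W → A.carrier} (hab : α.rel a b) (hcd : ∀ w, α.rel (c w) (d w))
    (h : A.evalTrm (oe a c) t = A.evalTrm (oe b c) t) :
    A.evalTrm (oe a d) t = A.evalTrm (oe b d) t := by
  have key : ∀ (a : A.carrier) (c : W → A.carrier),
      A.evalTrm (Sum.elim c (fun _ : Unit => a))
        (tm (fun o : Option W => o.elim (Sum.inr ()) Sum.inl) t) = A.evalTrm (oe a c) t := by
    intro a c
    rw [eval_tm]; congr 1; funext o; cases o <;> rfl
  have := centralizes_gen (abelian_iff.1 hα)
    (tm (fun o : Option W => o.elim (Sum.inr ()) Sum.inl) t) c d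
    (fun _ : Unit => a) (fun _ => b) hcd (fun _ => hab) (bot_rel.2 (by rw [key, key, h]))
  rwa [key, key, bot_rel] at this

theorem Rho.diag (hα : IsAbelianCong α) {a b : A.carrier} (h : α.rel a b) : Rho α a a b b :=
  ⟨α.iseqv.refl a, h, h, fun _ t _ _ hcd =>
    ⟨tc_diag hα t h hcd, tc_diag hα t (α.iseqv.symm h) hcd⟩⟩

theorem Rho.op1 (f : σ.ops) (i : Fin (σ.arity f)) (c d : Fin (σ.arity f) → A.carrier)
    (hcd : ∀ j, α.rel (c j) (d j)) {a b a' b' : A.carrier} (h : Rho α a b a' b') :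
    Rho α (A.interp f (Function.update c i a)) (A.interp f (Function.update d i b))
      (A.interp f (Function.update c i a')) (A.interp f (Function.update d i b')) := by
  have up : ∀ (e e' : Fin (σ.arity f) → A.carrier) (p q : A.carrier), (∀ j, α.rel (e j) (e' j)) →
      α.rel p q → α.rel (A.interp f (Function.update e i p)) (A.interp f (Function.update e' i q)) := by
    intro e e' p q he hpq
    apply α.compat
    intro j
    by_cases hj : j = i
    · subst hj; simpa using hpq
    · simpa [hj] using he j
  refine ⟨up _ _ _ _ hcd h.1, up _ _ _ _ (fun j => α.iseqv.refl _) h.2.1, up _ _ _ _ hcd h.2.2.1, ?_⟩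
  intro W t u v huv
  let t' : Trm σ (Option (Fin (σ.arity f) ⊕ W)) :=
    tb (oe (.op f fun j => if j = i then .var none else .var (some (.inl j)))
      (fun w => .var (some (.inr w)))) t
  have key : ∀ (p : A.carrier) (e : Fin (σ.arity f) → A.carrier) (u : W → A.carrier),
      A.evalTrm (oe p (Sum.elim e u)) t' = A.evalTrm (oe (A.interp f (Function.update e i p)) u) t := by
    intro p e u
    rw [eval_tb]
    congr 1; funext o
    cases o with
    | some w => rfl
    | none =>
      simp only [oe, Option.elim, Alg.evalTrm]
      congr 1; funext j
      by_cases hj : j = i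
      · subst hj; simp [Alg.evalTrm, oe]
      · simp [hj, Alg.evalTrm, oe]
  have := h.2.2.2 _ t' (Sum.elim c u) (Sum.elim d v) (by rintro (j | w); exacts [hcd j, huv w])
  rwa [key, key, key, key] at this

theorem Rho.op (f : σ.ops) (a b a' b' : Fin (σ.arity f) → A.carrier)
    (h : ∀ i, Rho α (a i) (b i) (a' i) (b' i)) :
    Rho α (A.interp f a) (A.interp f b) (A.interp f a') (A.interp f b') := by
  refine hybrid (X := A.carrier × A.carrier) (Y := A.carrier × A.carrier)
    (fun p q => Rho α p.1 p.2 q.1 q.2)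
    (fun p => (A.interp f fun j => (p j).1, A.interp f fun j => (p j).2))
    (fun j => (a j, b j)) (fun j => (a' j, b' j)) ?_ (fun _ _ _ => Rho.trans) ?_
  · exact Rho.refl (α.compat f _ _ fun j => (h j).1)
  · intro i c hc
    have := Rho.op1 f i (fun j => (c j).1) (fun j => (c j).2) (fun j => by
      rcases hc j with e | e <;> simp only [e]
      · exact (h j).1
      · exact (h j).symm.1) (h i)
    have e1 : ∀ p : A.carrier × A.carrier, (fun j => (Function.update c i p j).1) =
        Function.update (fun j => (c j).1) i p.1 := by
      intro p; funext j; by_cases hj : j = i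
      · subst hj; simp
      · simp [hj]
    have e2 : ∀ p : A.carrier × A.carrier, (fun j => (Function.update c i p j).2) =
        Function.update (fun j => (c j).2) i p.2 := by
      intro p; funext j; by_cases hj : j = i
      · subst hj; simp
      · simp [hj]
    simp only [e1, e2]
    exact this

theorem Rho.term {W : Type} (t : Trm σ W) (a b a' b' : W → A.carrier)
    (h : ∀ i, Rho α (a i) (b i) (a' i) (b' i)) :
    Rho α (A.evalTrm a t) (A.evalTrm b t) (A.evalTrm a' t) (A.evalTrm b' t) := by
  induction t with
  | var v => exact h v
  | op f ts ih => exact Rho.op f _ _ _ _ ih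

/-- Taylor-like term, evaluated in an algebra. -/
def TaylorIn (A : Alg σ) : Prop := ∃ (n : ℕ) (T : Trm σ (Fin n)),
  (∀ c : A.carrier, A.evalTrm (fun _ => c) T = c) ∧
  ∀ i : Fin n, ∃ w z : Fin n → Bool, w i ≠ z i ∧
    ∀ e : Bool → A.carrier, A.evalTrm (fun j => e (w j)) T = A.evalTrm (fun j => e (z j)) T

theorem Rho.claim2 (hα : IsAbelianCong α) (hT : TaylorIn A) {e0 e1 e0' e1' e2' : A.carrier}
    (h : Rho α e0 e1 e0' e1') (k : Rho α e1 e0 e1' e2') : e0' = e2' := by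
  obtain ⟨n, T, hid, hT⟩ := hT
  have h2 : α.rel e0' e2' := α.iseqv.trans (α.iseqv.symm h.2.1) (α.iseqv.trans h.1 k.2.2.1)
  rw [← hid e0', ← hid e2']
  refine hybrid (· = ·) (fun c : Fin n → A.carrier => A.evalTrm c T) (fun _ => e0') (fun _ => e2')
    rfl (fun _ _ _ => Eq.trans) ?_
  intro i c hc
  have hwz : ∃ w z : Fin n → Bool, w i = false ∧ z i = true ∧
    ∀ e : Bool → A.carrier, A.evalTrm (fun j => e (w j)) T = A.evalTrm (fun j => e (z j)) T := by
    obtain ⟨w, z, hn, he⟩ := hT i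
    cases hw : w i <;> cases hz : z i
    · exact absurd (hw.trans hz.symm) hn
    · exact ⟨w, z, hw, hz, he⟩
    · exact ⟨z, w, hz, hw, fun e => (he e).symm⟩
    · exact absurd (hw.trans hz.symm) hn
  obtain ⟨w, z, hw, hz, he⟩ := hwz
  let t : Trm σ (Option (Fin n)) := tm (fun j => if j = i then none else some j) T
  have key : ∀ (p : A.carrier) (c : Fin n → A.carrier),
      A.evalTrm (oe p c) t = A.evalTrm (Function.update c i p) T := by
    intro p c
    rw [eval_tm]
    congr 1; funext j
    by_cases hj : j = i
    · subst hj; simp [oe]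
    · simp [hj, oe]
  let e : Bool → A.carrier := fun b => cond b e1 e0
  have hee : ∀ b b', α.rel (e b) (e b') := by
    intro b b'
    cases b <;> cases b'
    exacts [α.iseqv.refl _, h.1, k.1, α.iseqv.refl _]
  have q1 := h.2.2.2 _ t (fun j => e (w j)) (fun j => e (z j)) (fun j => hee _ _)
  have q2 := k.2.2.2 _ t (fun j => e (z j)) (fun j => e (w j)) (fun j => hee _ _)
  have u0 : Function.update (fun j => e (w j)) i e0 = fun j => e (w j) :=
    Function.update_eq_self_iff.2 (by simp [hw, e])
  have u1 : Function.update (fun j => e (z j)) i e1 = fun j => e (z j) :=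
    Function.update_eq_self_iff.2 (by simp [hz, e])
  have r1 := q1.1 (by rw [key, key, u0, u1]; exact he e)
  have r2 := q2.1 (by rw [key, key, u0, u1]; exact (he e).symm)
  have r3 := tc_side hα t (c := fun j => e (w j)) (d := c) h2 (fun j => by
    have : α.rel (e (w j)) e0' := α.iseqv.trans (hee (w j) false) h.2.1
    rcases hc j with hj | hj <;> rw [hj]
    · exact this
    · exact α.iseqv.trans this h2) (r1.trans r2)
  rwa [key, key] at r3

theorem Rho.path1 (hα : IsAbelianCong α) (hT : TaylorIn A) {a b c a' b' c' : A.carrier}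
    (h : Rho α a b a' b') (k : Rho α b c b' c') {W : Type} (t : Trm σ (Option W))
    (u v : W → A.carrier) (huv : ∀ w, α.rel (u w) (v w))
    (e : A.evalTrm (oe a u) t = A.evalTrm (oe c v) t) :
    A.evalTrm (oe a' u) t = A.evalTrm (oe c' v) t := by
  have r1 : Rho α (A.evalTrm (oe a u) t) (A.evalTrm (oe b u) t) (A.evalTrm (oe a' u) t)
      (A.evalTrm (oe b' u) t) := Rho.term t _ _ _ _ fun o => by
    cases o with
    | none => exact h
    | some w => exact Rho.refl (α.iseqv.refl _)
  have r2 : Rho α (A.evalTrm (oe b u) t) (A.evalTrm (oe c v) t) (A.evalTrm (oe b' u) t)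
      (A.evalTrm (oe c' v) t) := Rho.term t _ _ _ _ fun o => by
    cases o with
    | none => exact k
    | some w => exact Rho.refl (huv w)
  rw [← e] at r2
  exact Rho.claim2 hα hT r1 r2

theorem Rho.path (hα : IsAbelianCong α) (hT : TaylorIn A) {a b c a' b' c' : A.carrier}
    (h : Rho α a b a' b') (k : Rho α b c b' c') : Rho α a c a' c' :=
  ⟨α.iseqv.trans h.1 k.1, h.2.1, α.iseqv.trans h.1 k.2.2.1, fun _ t u v huv =>
    ⟨Rho.path1 hα hT h k t u v huv, Rho.path1 hα hT h.symm k.symm t u v huv⟩⟩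

theorem Rho.unique (hα : IsAbelianCong α) (hT : TaylorIn A) {a b b' : A.carrier}
    (h : Rho α a b a b') : b = b' :=
  (Rho.eq_of (Rho.path hα hT h.swap (Rho.refl h.1))).symm

end rho

/-! ### The generic algebra -/

theorem vec2_const {X : Type} (z : X) : (![z, z] : Fin 2 → X) = fun _ => z := by
  funext i; fin_cases i <;> rfl

theorem exists_generic (V : Variety σ) : ∃ (A : Alg σ) (α : Congruence A) (x y : A.carrier),
    V.Mem A ∧ IsAbelianCong α ∧ α.rel x y ∧
    (∀ a, ∃ s : Trm σ (Fin 2), A.evalTrm ![x, y] s = a) ∧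
    (∀ s s' : Trm σ (Fin 2), α.rel (A.evalTrm ![x, y] s) (A.evalTrm ![x, y] s') →
      A.evalTrm ![y, y] s = A.evalTrm ![y, y] s') ∧
    (∀ s s' : Trm σ (Fin 2), A.evalTrm ![x, y] s = A.evalTrm ![x, y] s' →
      ∀ B : Alg σ, V.Mem B → ∀ γ : Congruence B, IsAbelianCong γ → ∀ b b', γ.rel b b' →
        B.evalTrm ![b, b'] s = B.evalTrm ![b, b'] s') := by
  let g : Congruence (TA σ (Fin 2)) :=
    { rel := fun s s' => ∀ B : Alg σ, V.Mem B → ∀ γ : Congruence B, IsAbelianCong γ →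
        ∀ b b', γ.rel b b' → B.evalTrm ![b, b'] s = B.evalTrm ![b, b'] s'
      iseqv := ⟨fun s B _ γ _ b b' _ => rfl,
        fun h B hB γ hγ b b' k => (h B hB γ hγ b b' k).symm,
        fun h h' B hB γ hγ b b' k => (h B hB γ hγ b b' k).trans (h' B hB γ hγ b b' k)⟩
      compat := fun f s s' h B hB γ hγ b b' k =>
        congrArg (B.interp f) (funext fun i => h i B hB γ hγ b b' k) }
  let a : Congruence (TA σ (Fin 2)) :=
    { rel := fun s s' => ∀ B : Alg σ, V.Mem B → ∀ z : B.carrier,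
        B.evalTrm (fun _ => z) s = B.evalTrm (fun _ => z) s'
      iseqv := ⟨fun s B _ z => rfl,
        fun h B hB z => (h B hB z).symm,
        fun h h' B hB z => (h B hB z).trans (h' B hB z)⟩
      compat := fun f s s' h B hB z => congrArg (B.interp f) (funext fun i => h i B hB z) }
  have hga : g ≤ a := by
    intro s s' h B hB z
    have := h B hB ⊥ bot_abelian z z (bot_rel.2 rfl)
    rwa [vec2_const] at this
  have hc : Centralizes a a g := by
    intro m n t p q u v hpq huv h B hB γ hγ b b' hb
    have key : ∀ (p : Fin m → Trm σ (Fin 2)) (u : Fin n → Trm σ (Fin 2)),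
        B.evalTrm ![b, b'] ((TA σ (Fin 2)).evalTrm (Sum.elim p u) t) =
        B.evalTrm (Sum.elim (fun i => B.evalTrm ![b, b'] (p i)) (fun i => B.evalTrm ![b, b'] (u i))) t := by
      intro p u
      rw [TA_eval, eval_tb]
      congr 1; funext k; cases k <;> rfl
    have hr : ∀ s s' : Trm σ (Fin 2), a.rel s s' →
        γ.rel (B.evalTrm ![b, b'] s) (B.evalTrm ![b, b'] s') := by
      intro s s' hs
      have h1 : ∀ s : Trm σ (Fin 2), γ.rel (B.evalTrm (fun _ => b) s) (B.evalTrm ![b, b'] s) := by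
        intro s
        apply cong_term
        intro i
        fin_cases i
        · exact γ.iseqv.refl _
        · exact hb
      have h2 := h1 s
      rw [hs B hB b] at h2
      exact γ.iseqv.trans (γ.iseqv.symm h2) (h1 s')
    have h0 := h B hB γ hγ b b' hb
    refine (key q u).trans (Eq.trans ?_ (key q v).symm)
    replace h0 := (key p u).symm.trans (h0.trans (key p v))
    exact bot_rel.1 (abelian_iff.1 hγ m n t _ _ _ _ (fun i => hr _ _ (hpq i)) (fun i => hr _ _ (huv i))
      (bot_rel.2 h0))
  have hev : ∀ s : Trm σ (Fin 2), (quotAlg (TA σ (Fin 2)) g).evalTrm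
      ![qm g (Trm.var 0 : Trm σ (Fin 2)), qm g (Trm.var 1 : Trm σ (Fin 2))] s = qm g s := by
    intro s
    have := quot_eval g s (fun i : Fin 2 => (Trm.var i : Trm σ (Fin 2)))
    rw [TA_eval] at this
    have e : tb (fun i : Fin 2 => (Trm.var i : Trm σ (Fin 2))) s = s := tm_id s
    rw [e] at this
    rw [← this]
    congr 1; funext i; fin_cases i <;> rfl
  have hmem : V.Mem (quotAlg (TA σ (Fin 2)) g) :=
    quot_mem V g fun s t h B hB γ hγ b b' hb => h B hB _
  refine ⟨quotAlg (TA σ (Fin 2)) g, push g a hga, qm g (Trm.var 0 : Trm σ (Fin 2)),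
    qm g (Trm.var 1 : Trm σ (Fin 2)), hmem, ?_, ?_, ?_, ?_, ?_⟩
  · rw [abelian_iff, ← push_bot]
    exact push_centralizes hc
  · rw [push_rel]
    intro B hB z
    rfl
  · intro q
    exact ⟨qo g q, (hev _).trans (qm_qo g q)⟩
  · intro s s' h
    rw [hev, hev, push_rel] at h
    rw [vec2_const]
    exact h _ hmem _
  · intro s s' h
    rw [hev, hev, qm_eq] at h
    exact h

/-! ### The congruence on `A(α)` -/

/-- Specialised term-generated relation. -/
def SR (x y : A.carrier) (c' c : A.carrier) : Prop :=
  ∃ t : Trm σ (Fin 3), A.evalTrm ![x, x, y] t = c' ∧ A.evalTrm ![y, x, y] t = c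

/-- The fibres of the critical congruence. -/
inductive KR (α : Congruence A) (x y : A.carrier) : A.carrier → A.carrier → A.carrier → Prop
  | gen {c c' : A.carrier} : SR x y c' c → KR α x y c c' c
  | refl {c a : A.carrier} : α.rel c a → KR α x y c a a
  | symm {c a b : A.carrier} : KR α x y c a b → KR α x y c b a
  | trans {c a b d : A.carrier} : KR α x y c a b → KR α x y c b d → KR α x y c a d
  | par {c a b a' b' : A.carrier} : KR α x y c a b → Rho α a b a' b' → KR α x y c a' b'

section

variable {α : Congruence A} {x y : A.carrier}

theorem SR.alpha (hxy : α.rel x y) {c' c : A.carrier} (h : SR x y c' c) : α.rel c' c := by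
  obtain ⟨t, rfl, rfl⟩ := h
  apply cong_term
  intro i
  fin_cases i
  exacts [hxy, α.iseqv.refl _, α.iseqv.refl _]

theorem SR.refl (hs : ∀ a, ∃ s : Trm σ (Fin 2), A.evalTrm ![x, y] s = a) (c : A.carrier) :
    SR x y c c := by
  obtain ⟨s, rfl⟩ := hs c
  refine ⟨tm ![1, 2] s, ?_, ?_⟩ <;> rw [eval_tm] <;> congr 1 <;> funext i <;> fin_cases i <;> rfl

theorem SR.op (f : σ.ops) (a b : Fin (σ.arity f) → A.carrier) (h : ∀ i, SR x y (a i) (b i)) :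
    SR x y (A.interp f a) (A.interp f b) := by
  choose t h1 h2 using h
  refine ⟨.op f t, ?_, ?_⟩
  · simp only [Alg.evalTrm, h1]
  · simp only [Alg.evalTrm, h2]

theorem KR.tr (hα : IsAbelianCong α) (hxy : α.rel x y)
    (hs : ∀ a, ∃ s : Trm σ (Fin 2), A.evalTrm ![x, y] s = a) (f : σ.ops) (i : Fin (σ.arity f))
    (e1 e2 : Fin (σ.arity f) → A.carrier) (he : ∀ j, α.rel (e1 j) (e2 j)) {c a b : A.carrier}
    (h : KR α x y c a b) : KR α x y (A.interp f (Function.update e2 i c))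
      (A.interp f (Function.update e1 i a)) (A.interp f (Function.update e1 i b)) := by
  induction h with
  | @gen c' h =>
    refine KR.par (KR.gen (c' := A.interp f (Function.update e2 i c')) ?_) ?_
    · apply SR.op
      intro j
      by_cases hj : j = i
      · subst hj; simpa using h
      · simpa [hj] using SR.refl hs (e2 j)
    · apply Rho.op
      intro j
      by_cases hj : j = i
      · subst hj; simpa using Rho.refl (h.alpha hxy)
      · simpa [hj] using Rho.diag hα (α.iseqv.symm (he j))
  | @refl a h =>
    apply KR.refl
    apply α.compat
    intro j
    by_cases hj : j = i
    · subst hj; simpa using h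
    · simpa [hj] using α.iseqv.symm (he j)
  | symm _ ih => exact ih.symm
  | trans _ _ ih1 ih2 => exact ih1.trans ih2
  | @par a b a' b' _ hr ih =>
    exact ih.par (Rho.op1 f i e1 e1 (fun j => α.iseqv.refl _) hr)

theorem update_proj {I X Y : Type} [DecidableEq I] (g : X → Y) (e : I → X) (i : I) (p : X) :
    (fun j => g (Function.update e i p j)) = Function.update (fun j => g (e j)) i (g p) := by
  funext j
  by_cases hj : j = i
  · subst hj; simp
  · simp [hj]

/-- The critical congruence on `A(α)`. -/
def dC (hα : IsAbelianCong α) (hxy : α.rel x y)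
    (hs : ∀ a, ∃ s : Trm σ (Fin 2), A.evalTrm ![x, y] s = a) : Congruence (algOn A α) :=
  mkCong (A := algOn A α) (fun p q => p.1.2 = q.1.2 ∧ KR α x y p.1.2 p.1.1 q.1.1)
    ⟨fun p => ⟨rfl, KR.refl (α.iseqv.symm p.2)⟩,
      fun h => ⟨h.1.symm, h.1 ▸ h.2.symm⟩,
      fun h k => ⟨h.1.trans k.1, h.2.trans (h.1 ▸ k.2)⟩⟩
    (by
      intro f e i p q h
      have k1 : ∀ p : (algOn A α).carrier, (((algOn A α).interp f (Function.update e i p)).1.1) =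
          A.interp f (Function.update (fun j => (e j).1.1) i p.1.1) := fun p =>
        congrArg (A.interp f) (update_proj (fun p : (algOn A α).carrier => p.1.1) e i p)
      have k2 : ∀ p : (algOn A α).carrier, (((algOn A α).interp f (Function.update e i p)).1.2) =
          A.interp f (Function.update (fun j => (e j).1.2) i p.1.2) := fun p =>
        congrArg (A.interp f) (update_proj (fun p : (algOn A α).carrier => p.1.2) e i p)
      rw [k1, k1, k2, k2]
      refine ⟨by rw [h.1], ?_⟩
      exact KR.tr hα hxy hs f i _ _ (fun j => (e j).2) h.2)

/-- The lift of `α` to `A(α)`. -/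
def aC (α : Congruence A) : Congruence (algOn A α) where
  rel p q := α.rel p.1.1 q.1.1
  iseqv := ⟨fun _ => α.iseqv.refl _, α.iseqv.symm, α.iseqv.trans⟩
  compat f a b h := α.compat f _ _ h

theorem aC_2 {p q : (algOn A α).carrier} (h : (aC α).rel p q) : α.rel p.1.2 q.1.2 :=
  α.iseqv.trans (α.iseqv.symm p.2) (α.iseqv.trans h q.2)

theorem algOn_eval1 {W : Type} (t : Trm σ W) (a : W → (algOn A α).carrier) :
    ((algOn A α).evalTrm a t).1.1 = A.evalTrm (fun w => (a w).1.1) t := by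
  induction t with
  | var v => rfl
  | op f ts ih => exact congrArg (A.interp f) (funext ih)

theorem algOn_eval2 {W : Type} (t : Trm σ W) (a : W → (algOn A α).carrier) :
    ((algOn A α).evalTrm a t).1.2 = A.evalTrm (fun w => (a w).1.2) t := by
  induction t with
  | var v => rfl
  | op f ts ih => exact congrArg (A.interp f) (funext ih)

theorem algOn_mem (V : Variety σ) (hA : V.Mem A) : V.Mem (algOn A α) :=
  V.closed_sub (V.closed_prod (fun _ : Bool => A) fun _ => hA)
    ⟨⟨fun p b => cond b p.1.1 p.1.2, fun f a => by funext b; cases b <;> rfl⟩, by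
      intro p q h
      have h1 := congrFun h true
      have h2 := congrFun h false
      exact Subtype.ext (Prod.ext h1 h2)⟩

theorem sum_elim_comp {P Q X Y : Type} (g : X → Y) (a : P → X) (u : Q → X) :
    (fun w => g (Sum.elim a u w)) = Sum.elim (fun i => g (a i)) (fun i => g (u i)) := by
  funext w; cases w <;> rfl

theorem aC_abelian (hα : IsAbelianCong α) : IsAbelianCong (aC α) := by
  rw [abelian_iff]
  intro m n t a b u v hab huv h
  rw [bot_rel] at h ⊢
  have h1 := congrArg (fun p : (algOn A α).carrier => p.1.1) h
  have h2 := congrArg (fun p : (algOn A α).carrier => p.1.2) h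
  simp only [algOn_eval1, algOn_eval2] at h1 h2
  rw [sum_elim_comp (fun p : (algOn A α).carrier => p.1.1),
    sum_elim_comp (fun p : (algOn A α).carrier => p.1.1)] at h1
  rw [sum_elim_comp (fun p : (algOn A α).carrier => p.1.2),
    sum_elim_comp (fun p : (algOn A α).carrier => p.1.2)] at h2
  refine Subtype.ext (Prod.ext ?_ ?_)
  · rw [algOn_eval1, algOn_eval1, sum_elim_comp (fun p : (algOn A α).carrier => p.1.1),
      sum_elim_comp (fun p : (algOn A α).carrier => p.1.1)]
    exact bot_rel.1 (abelian_iff.1 hα m n t _ _ _ _ (fun i => hab i) (fun i => huv i) (bot_rel.2 h1))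
  · rw [algOn_eval2, algOn_eval2, sum_elim_comp (fun p : (algOn A α).carrier => p.1.2),
      sum_elim_comp (fun p : (algOn A α).carrier => p.1.2)]
    exact bot_rel.1 (abelian_iff.1 hα m n t _ _ _ _ (fun i => aC_2 (hab i)) (fun i => aC_2 (huv i))
      (bot_rel.2 h2))

theorem dC_centralizes (hα : IsAbelianCong α) (hxy : α.rel x y)
    (hs : ∀ a, ∃ s : Trm σ (Fin 2), A.evalTrm ![x, y] s = a) :
    Centralizes (eta2 A α) (aC α) (dC hα hxy hs) := by
  intro m n t a b u v hab huv h
  have hr : Rho α ((algOn A α).evalTrm (Sum.elim a u) t).1.1 ((algOn A α).evalTrm (Sum.elim a v) t).1.1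
      ((algOn A α).evalTrm (Sum.elim b u) t).1.1 ((algOn A α).evalTrm (Sum.elim b v) t).1.1 := by
    rw [algOn_eval1, algOn_eval1, algOn_eval1, algOn_eval1]
    apply Rho.term
    rintro (i | i)
    · apply Rho.diag hα
      have : (a i).1.2 = (b i).1.2 := hab i
      have h1 := (a i).2
      rw [this] at h1
      exact α.iseqv.trans h1 (α.iseqv.symm (b i).2)
    · exact Rho.refl (huv i)
  have e : ∀ u, ((algOn A α).evalTrm (Sum.elim a u) t).1.2 = ((algOn A α).evalTrm (Sum.elim b u) t).1.2 := by
    intro u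
    rw [algOn_eval2, algOn_eval2]
    congr 1
    funext k
    rcases k with i | i
    · exact hab i
    · rfl
  refine ⟨(e u).symm.trans (h.1.trans (e v)), ?_⟩
  rw [← e u]
  exact h.2.par hr

theorem join_top (hα : IsAbelianCong α) (hxy : α.rel x y)
    (hs : ∀ a, ∃ s : Trm σ (Fin 2), A.evalTrm ![x, y] s = a)
    (h2 : ∀ s s' : Trm σ (Fin 2), α.rel (A.evalTrm ![x, y] s) (A.evalTrm ![x, y] s') →
      A.evalTrm ![y, y] s = A.evalTrm ![y, y] s') :
    aC α ≤ eta1 A α ⊔ dC hα hxy hs := by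
  have hr : ∀ s : Trm σ (Fin 2), α.rel (A.evalTrm ![x, y] s) (A.evalTrm ![y, y] s) := by
    intro s
    apply cong_term
    intro i
    fin_cases i
    exacts [hxy, α.iseqv.refl _]
  have step : ∀ (p : (algOn A α).carrier) (s : Trm σ (Fin 2)), A.evalTrm ![x, y] s = p.1.1 →
      (eta1 A α ⊔ dC hα hxy hs).rel p
        ⟨(A.evalTrm ![y, y] s, A.evalTrm ![y, y] s), α.iseqv.refl _⟩ := by
    intro p s hp
    refine (eta1 A α ⊔ dC hα hxy hs).iseqv.trans
      (y := ⟨(A.evalTrm ![x, y] s, A.evalTrm ![y, y] s), hr s⟩) ?_ ?_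
    · exact (le_sup_left : eta1 A α ≤ _) _ _ hp.symm
    · refine (le_sup_right : dC hα hxy hs ≤ eta1 A α ⊔ _) _ _ ⟨rfl, KR.gen ⟨tm ![0, 2] s, ?_, ?_⟩⟩ <;>
      rw [eval_tm] <;> congr 1 <;> funext i <;> fin_cases i <;> rfl
  intro p q hpq
  obtain ⟨s, hsp⟩ := hs p.1.1
  obtain ⟨s', hsq⟩ := hs q.1.1
  have e := h2 s s' (by rw [hsp, hsq]; exact hpq)
  have q1 := step p s hsp
  have q2 := step q s' hsq
  have e' : (⟨(A.evalTrm ![y, y] s, A.evalTrm ![y, y] s), α.iseqv.refl _⟩ : (algOn A α).carrier) =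
      ⟨(A.evalTrm ![y, y] s', A.evalTrm ![y, y] s'), α.iseqv.refl _⟩ :=
    Subtype.ext (by simp only [e])
  rw [e'] at q1
  exact (eta1 A α ⊔ dC hα hxy hs).iseqv.trans q1 ((eta1 A α ⊔ dC hα hxy hs).iseqv.symm q2)

end

/-- Condition (5). -/
def NoPent (V : Variety σ) : Prop := ∀ A : Alg σ, V.Mem A →
  ¬ ∃ α β δ θ : Congruence A, IsPentagon ⊥ β δ θ α ∧ IsAbelianCong α ∧ Centralizes θ α δ

theorem K_main {V : Variety σ} (h5 : NoPent V) (hA : V.Mem A) {α : Congruence A} {x y : A.carrier}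
    (hα : IsAbelianCong α) (hxy : α.rel x y)
    (hs : ∀ a, ∃ s : Trm σ (Fin 2), A.evalTrm ![x, y] s = a)
    (h2 : ∀ s s' : Trm σ (Fin 2), α.rel (A.evalTrm ![x, y] s) (A.evalTrm ![x, y] s') →
      A.evalTrm ![y, y] s = A.evalTrm ![y, y] s') : KR α x y x x y := by
  by_contra hn
  have le : dC hα hxy hs ≤ eta2 A α := fun p q h => h.1
  have le2 : eta2 A α ≤ aC α := by
    intro p q h
    have h1 := p.2
    rw [show p.1.2 = q.1.2 from h] at h1
    exact α.iseqv.trans h1 (α.iseqv.symm q.2)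
  have le1 : eta1 A α ≤ aC α := by
    intro p q h
    change α.rel p.1.1 q.1.1
    rw [show p.1.1 = q.1.1 from h]
    exact α.iseqv.refl _
  have jt := join_top hα hxy hs h2
  have mb : eta1 A α ⊓ eta2 A α = ⊥ := by
    apply le_antisymm _ bot_le
    intro p q h
    rw [inf_rel] at h
    exact bot_rel.2 (Subtype.ext (Prod.ext h.1 h.2))
  refine h5 _ (algOn_mem (α := α) V hA) ⟨aC α, eta1 A α, dC hα hxy hs, eta2 A α, ⟨?_, mb, ?_, ?_, ?_⟩,
    aC_abelian hα, dC_centralizes hα hxy hs⟩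
  · refine lt_of_le_of_ne le fun e => hn ?_
    have : (eta2 A α).rel ⟨(x, x), α.iseqv.refl _⟩ ⟨(y, x), α.iseqv.symm hxy⟩ := rfl
    rw [← e] at this
    exact this.2
  · exact le_antisymm ((inf_le_inf_left _ le).trans mb.le) bot_le
  · exact le_antisymm (sup_le le1 (le.trans le2)) jt
  · exact le_antisymm (sup_le le1 le2) (jt.trans (sup_le_sup_left le _))

/-- Terms satisfying the first half of the weak difference identities. -/
def Mid (V : Variety σ) (m : Trm σ (Fin 3)) : Prop :=
  ∀ B : Alg σ, V.Mem B → ∀ γ : Congruence B, IsAbelianCong γ → ∀ b b', γ.rel b b' →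
    B.evalTrm ![b, b, b'] m = b'

theorem eval3 (B : Alg σ) (t : Trm σ (Fin 3)) (i j k : Fin 3) (g : Fin 3 → B.carrier) :
    B.evalTrm g (tm ![i, j, k] t) = B.evalTrm ![g i, g j, g k] t := by
  rw [eval_tm]; congr 1; funext l; fin_cases l <;> rfl

theorem eval32 (B : Alg σ) (t : Trm σ (Fin 3)) (i j k : Fin 2) (g : Fin 2 → B.carrier) :
    B.evalTrm g (tm ![i, j, k] t) = B.evalTrm ![g i, g j, g k] t := by
  rw [eval_tm]; congr 1; funext l; fin_cases l <;> rfl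

theorem Rho.term3 {α : Congruence A} (t : Trm σ (Fin 3)) {a1 b1 c1 d1 a2 b2 c2 d2 a3 b3 c3 d3 : A.carrier}
    (h1 : Rho α a1 b1 c1 d1) (h2 : Rho α a2 b2 c2 d2) (h3 : Rho α a3 b3 c3 d3) :
    Rho α (A.evalTrm ![a1, a2, a3] t) (A.evalTrm ![b1, b2, b3] t) (A.evalTrm ![c1, c2, c3] t)
      (A.evalTrm ![d1, d2, d3] t) := by
  apply Rho.term
  intro i
  fin_cases i
  exacts [h1, h2, h3]

theorem K_term {V : Variety σ} (hA : V.Mem A) (hT : TaylorIn A) {α : Congruence A} {x y : A.carrier}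
    (hα : IsAbelianCong α) (hxy : α.rel x y)
    (hg : ∀ s s' : Trm σ (Fin 2), A.evalTrm ![x, y] s = A.evalTrm ![x, y] s' →
      ∀ B : Alg σ, V.Mem B → ∀ γ : Congruence B, IsAbelianCong γ → ∀ b b', γ.rel b b' →
        B.evalTrm ![b, b'] s = B.evalTrm ![b, b'] s') {c a b : A.carrier} (h : KR α x y c a b) :
    c = x → ∃ m : Trm σ (Fin 3), Mid V m ∧ Rho α a b x (A.evalTrm ![y, x, x] m) := by
  have rx : Rho α x x x x := Rho.refl (α.iseqv.refl _)
  have dyx : Rho α y y x x := Rho.diag hα (α.iseqv.symm hxy)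
  have rxy : Rho α x y x y := Rho.refl hxy
  induction h with
  | @gen c' h =>
    rintro rfl
    obtain ⟨t, h1, h2⟩ := h
    have hm : Mid V (tm ![0, 2, 1] t) := by
      intro B hB γ hγ b b' hb
      rw [eval3]
      have := hg (tm ![1, 0, 1] t) (.var 0) (by rw [eval32]; exact h2) B hB γ hγ b' b (γ.iseqv.symm hb)
      rw [eval32] at this
      exact this
    refine ⟨_, hm, ?_⟩
    have r := Rho.term3 t rxy rx dyx
    have e := hm A hA α hα c c (α.iseqv.refl _)
    rw [eval3] at e ⊢
    have e' : A.evalTrm ![c, c, c] t = c := e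
    rw [h1, h2, e'] at r
    exact r
  | @refl a h =>
    rintro rfl
    exact ⟨.var 2, fun B hB γ hγ b b' hb => rfl, Rho.diag hα (α.iseqv.symm h)⟩
  | symm _ ih =>
    intro hc
    obtain ⟨m, hm, hr⟩ := ih hc
    refine ⟨tm ![1, 0, 2] m, ?_, ?_⟩
    · intro B hB γ hγ b b' hb
      rw [eval3]
      exact hm B hB γ hγ b b' hb
    · refine hr.swap.trans ?_
      have r := Rho.term3 m dyx rxy rx
      rw [hm A hA α hα y x (α.iseqv.symm hxy), hm A hA α hα x x (α.iseqv.refl _)] at r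
      rw [eval3]
      exact r
  | trans _ _ ih1 ih2 =>
    intro hc
    obtain ⟨m, hm, hr⟩ := ih1 hc
    obtain ⟨m', hm', hr'⟩ := ih2 hc
    have ev : ∀ (B : Alg σ) (p q r : B.carrier),
        B.evalTrm ![p, q, r] (tb ![.var 0, .var 1, m] m') =
        B.evalTrm ![p, q, B.evalTrm ![p, q, r] m] m' := by
      intro B p q r
      rw [eval_tb]; congr 1; funext l; fin_cases l <;> rfl
    refine ⟨tb ![.var 0, .var 1, m] m', ?_, ?_⟩
    · intro B hB γ hγ b b' hb
      rw [ev, hm B hB γ hγ b b' hb, hm' B hB γ hγ b b' hb]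
    · rw [ev]
      have hu : α.rel x (A.evalTrm ![y, x, x] m) := by
        have := hr.symm.1
        exact this
      have r := Rho.term3 m' rxy rx (Rho.diag hα hu)
      rw [hm' A hA α hα x x (α.iseqv.refl _), hm' A hA α hα x _ hu] at r
      exact Rho.path hα hT hr (hr'.trans r)
  | par _ hr ih =>
    intro hc
    obtain ⟨m, hm, hr'⟩ := ih hc
    exact ⟨m, hm, hr.symm.trans hr'⟩

theorem wdt_of_taylor {V : Variety σ} (h5 : NoPent V) (hT : ∀ A : Alg σ, V.Mem A → TaylorIn A) :
    ∃ d : Trm σ (Fin 3), IsWeakDifferenceTrm V d := by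
  obtain ⟨A, α, x, y, hA, hα, hxy, hs, h2, hg⟩ := exists_generic V
  obtain ⟨m, hm, hr⟩ := K_term hA (hT A hA) hα hxy hg (K_main h5 hA hα hxy hs h2) rfl
  have e := Rho.unique hα (hT A hA) hr
  refine ⟨m, fun B hB γ hγ a b hab => ⟨hm B hB γ hγ a b hab, ?_⟩⟩
  have := hg (tm ![1, 0, 0] m) (.var 1) (by rw [eval32]; exact e.symm) B hB γ hγ b a (γ.iseqv.symm hab)
  rw [eval32] at this
  exact this

/-! ### A Taylor-like term from condition (5) -/

/-- Idempotent terms. -/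
def Idem (V : Variety σ) {X : Type} (t : Trm σ X) : Prop :=
  ∀ B : Alg σ, V.Mem B → ∀ c : B.carrier, B.evalTrm (fun _ => c) t = c

/-- Existence of a Taylor-like term. -/
def TaylorLike (V : Variety σ) : Prop := ∃ (n : ℕ) (T : Trm σ (Fin n)), Idem V T ∧
  ∀ i : Fin n, ∃ w z : Fin n → Bool, w i ≠ z i ∧ VEq V (tm w T) (tm z T)

theorem TaylorLike.taylorIn {V : Variety σ} (h : TaylorLike V) (A : Alg σ) (hA : V.Mem A) :
    TaylorIn A := by
  obtain ⟨n, T, hi, hT⟩ := h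
  refine ⟨n, T, hi A hA, fun i => ?_⟩
  obtain ⟨w, z, hn, he⟩ := hT i
  refine ⟨w, z, hn, fun e => ?_⟩
  have := he A hA e
  rwa [eval_tm, eval_tm] at this

theorem VEq.map {V : Variety σ} {X Y : Type} {s t : Trm σ X} (h : VEq V s t) (g : X → Y) :
    VEq V (tm g s) (tm g t) := by
  intro B hB asg
  rw [eval_tm, eval_tm]
  exact h B hB _

theorem VEq.symm {V : Variety σ} {X : Type} {s t : Trm σ X} (h : VEq V s t) : VEq V t s :=
  fun B hB asg => (h B hB asg).symm

theorem VEq.trans {V : Variety σ} {X : Type} {s t u : Trm σ X} (h : VEq V s t) (k : VEq V t u) :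
    VEq V s u := fun B hB asg => (h B hB asg).trans (k B hB asg)

theorem Idem.map {V : Variety σ} {X Y : Type} {s : Trm σ X} (h : Idem V s) (g : X → Y) :
    Idem V (tm g s) := by
  intro B hB c
  rw [eval_tm]
  exact h B hB c

theorem exists_good {V : Variety σ} (hn : ¬ TaylorLike V) {W : Type} (T : Trm σ W) (hT : Idem V T) :
    ∃ i : W, ∀ (Z : Type) (w z : W → Z), VEq V (tm w T) (tm z T) → w i = z i := by
  obtain ⟨n, e, T, rfl⟩ := finite_support T
  have hT' : Idem V T := by
    intro B hB c
    have := hT B hB c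
    rwa [eval_tm] at this
  have : ∃ i : Fin n, ∀ w z : Fin n → Bool, VEq V (tm w T) (tm z T) → w i = z i := by
    by_contra hc
    push Not at hc
    refine hn ⟨n, T, hT', fun i => ?_⟩
    obtain ⟨w, z, h1, h2⟩ := hc i
    exact ⟨w, z, h2, h1⟩
  obtain ⟨i, hi⟩ := this
  refine ⟨e i, fun Z w z h => ?_⟩
  classical
  by_contra hne
  have h' := h.map (fun y => decide (y = w (e i)))
  simp only [tm_tm] at h'
  have := hi _ _ h'
  simp at this
  exact hne this.symm

open Classical in
/-- Nested composition of all terms in a list. -/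
noncomputable def star {I Y : Type} (term : I → Trm σ Y) : List I → (I → Y) → Trm σ (I → Y)
  | [], b => .var b
  | s :: l, b => tb (fun k => star term l (Function.update b s k)) (term s)

theorem star_idem {V : Variety σ} {I Y : Type} (term : I → Trm σ Y) (hi : ∀ s, Idem V (term s))
    (l : List I) (b : I → Y) : Idem V (star term l b) := by
  classical
  induction l generalizing b with
  | nil => intro B hB c; rfl
  | cons s l ih =>
    intro B hB c
    rw [star, eval_tb]
    have : (fun v => B.evalTrm (fun _ => c) (star term l (Function.update b s v))) = fun _ => c :=
      funext fun v => ih _ B hB c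
    rw [this]
    exact hi s B hB c

theorem star_proj {V : Variety σ} {I Y : Type} (term : I → Trm σ Y) (hi : ∀ s, Idem V (term s))
    (l : List I) (b : I → Y) (s : I) : (s ∈ l → VEq V (tm (fun p => p s) (star term l b)) (term s)) ∧
      (s ∉ l → VEq V (tm (fun p => p s) (star term l b)) (.var (b s))) := by
  classical
  induction l generalizing b with
  | nil => exact ⟨fun h => by simp at h, fun _ B hB asg => rfl⟩
  | cons s' l ih =>
    have key : ∀ (B : Alg σ) (asg : Y → B.carrier),
        B.evalTrm asg (tm (fun p : I → Y => p s) (star term (s' :: l) b)) =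
        B.evalTrm (fun k => B.evalTrm asg (tm (fun p : I → Y => p s)
          (star term l (Function.update b s' k)))) (term s') := by
      intro B asg
      rw [eval_tm, star, eval_tb]
      congr 1; funext k
      rw [eval_tm]
    by_cases hl : s ∈ l
    · refine ⟨fun _ B hB asg => ?_, fun h => absurd (List.mem_cons_of_mem _ hl) h⟩
      rw [key]
      have : (fun k => B.evalTrm asg (tm (fun p : I → Y => p s)
          (star term l (Function.update b s' k)))) = fun _ => B.evalTrm asg (term s) :=
        funext fun k => (ih _).1 hl B hB asg
      rw [this]
      exact hi s' B hB _
    · have e : ∀ (B : Alg σ) (hB : V.Mem B) (asg : Y → B.carrier),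
        (fun k => B.evalTrm asg (tm (fun p : I → Y => p s)
          (star term l (Function.update b s' k)))) = fun k => asg (Function.update b s' k s) :=
        fun B hB asg => funext fun k => (ih _).2 hl B hB asg
      by_cases hs : s = s'
      · subst hs
        refine ⟨fun _ B hB asg => ?_, fun h => absurd List.mem_cons_self h⟩
        rw [key, e B hB]
        simp
      · refine ⟨fun h => ?_, fun _ B hB asg => ?_⟩
        · rcases List.mem_cons.1 h with h | h
          · exact absurd h hs
          · exact absurd h hl
        · rw [key, e B hB]
          simp only [Function.update_of_ne hs]
          exact hi s' B hB _

theorem exists_h {V : Variety σ} (hn : ¬ TaylorLike V) (Y : Type) [Finite Y] [Inhabited Y] :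
    ∃ h : Trm σ Y → Y, ∀ (s s' : Trm σ Y), Idem V s → Idem V s' → ∀ (Z : Type) (g g' : Y → Z),
      VEq V (tm g s) (tm g' s') → g (h s) = g' (h s') := by
  classical
  let I := {s : Trm σ Y // Idem V s}
  let term : I → Trm σ Y := fun s => s.1
  have hi : ∀ s, Idem V (term s) := fun s => s.2
  let T : Finset I → Trm σ (I → Y) := fun Φ => star term Φ.toList (fun _ => default)
  choose w hw using fun Φ : Finset I => exists_good hn (T Φ) (star_idem term hi _ _)
  have hw' : ∀ (Φ : Finset I) (s s' : I), s ∈ Φ → s' ∈ Φ → ∀ (Z : Type) (g g' : Y → Z),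
      VEq V (tm g s.1) (tm g' s'.1) → g (w Φ s) = g' (w Φ s') := by
    intro Φ s s' hs hs' Z g g' hv
    refine hw Φ Z (fun p => g (p s)) (fun p => g' (p s')) ?_
    have h1 := ((star_proj term hi Φ.toList (fun _ => default) s).1 (by simpa using hs)).map g
    have h2 := ((star_proj term hi Φ.toList (fun _ => default) s').1 (by simpa using hs')).map g'
    rw [tm_tm] at h1 h2
    exact h1.trans (VEq.trans hv h2.symm)
  let U : Ultrafilter (Finset I) := Ultrafilter.of Filter.atTop
  have hU : (U : Filter (Finset I)) ≤ Filter.atTop := Ultrafilter.of_le _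
  have hlim : ∀ s : I, ∃ y : Y, ∀ᶠ Φ in (U : Filter (Finset I)), w Φ s = y := by
    intro s
    obtain ⟨y, hy⟩ := Ultrafilter.eq_pure_of_finite (U.map fun Φ => w Φ s)
    refine ⟨y, ?_⟩
    have : ({y} : Set Y) ∈ U.map fun Φ => w Φ s := by rw [hy]; exact Ultrafilter.mem_pure.2 rfl
    exact this
  choose h0 hh0 using hlim
  refine ⟨fun s => if hs : Idem V s then h0 ⟨s, hs⟩ else default, ?_⟩
  intro s s' hs hs' Z g g' hv
  simp only [hs, hs', dif_pos]
  have ev : ∀ᶠ Φ in (U : Filter (Finset I)), (⟨s, hs⟩ : I) ∈ Φ ∧ (⟨s', hs'⟩ : I) ∈ Φ := by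
    apply hU
    filter_upwards [Filter.eventually_ge_atTop ({⟨s, hs⟩, ⟨s', hs'⟩} : Finset I)] with Φ hΦ
    exact ⟨hΦ (by simp), hΦ (by simp)⟩
  obtain ⟨Φ, ⟨h1, h2⟩, h3, h4⟩ := (ev.and ((hh0 ⟨s, hs⟩).and (hh0 ⟨s', hs'⟩))).exists
  rw [← h3, ← h4]
  exact hw' Φ _ _ h1 h2 Z g g' hv

def kC (V : Variety σ) (X : Type) : Congruence (TA σ X) where
  rel s s' := ∀ B : Alg σ, V.Mem B → ∀ z : B.carrier,
    B.evalTrm (fun _ => z) s = B.evalTrm (fun _ => z) s'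
  iseqv := ⟨fun s B _ z => rfl, fun h B hB z => (h B hB z).symm,
    fun h h' B hB z => (h B hB z).trans (h' B hB z)⟩
  compat f s s' h B hB z := congrArg (B.interp f) (funext fun i => h i B hB z)

theorem kC_idem {V : Variety σ} {X : Type} {s s' : Trm σ X} (h : (kC V X).rel s s') (hs : Idem V s) :
    Idem V s' := fun B hB c => (h B hB c).symm.trans (hs B hB c)

/-- Plug a term into the hole. -/
def plug {X : Type} (r : Trm σ (Option X)) (s : Trm σ X) : Trm σ X := tb (oe s Trm.var) r

theorem plug_k {V : Variety σ} {X : Type} (r : Trm σ (Option X)) {s s' : Trm σ X}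
    (h : (kC V X).rel s s') : (kC V X).rel (plug r s) (plug r s') := by
  intro B hB z
  rw [plug, plug, eval_tb, eval_tb]
  congr 1; funext o
  cases o
  · exact h B hB z
  · rfl

/-- Hypothesis on a choice function. -/
def IsChoice (V : Variety σ) {Y : Type} (h : Trm σ Y → Y) : Prop :=
  ∀ (s s' : Trm σ Y), Idem V s → Idem V s' → ∀ (Z : Type) (g g' : Y → Z),
      VEq V (tm g s) (tm g' s') → g (h s) = g' (h s')

abbrev BV := Fin 4 × Fin 3

/-- Induced choice on terms over `Fin 4`. -/
def HH (h : Trm σ BV → BV) (u : Trm σ (Fin 4)) : Fin 4 := (h (tm (fun x => (x, 0)) u)).1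

section choice

variable {V : Variety σ} {h : Trm σ BV → BV}

theorem HH_map (hh : IsChoice V h) (P : Trm σ BV) (hP : Idem V P) (g : BV → Fin 4) :
    HH h (tm g P) = g (h P) := by
  refine hh _ P ((hP.map g).map _) hP (Fin 4) Prod.fst g ?_
  rw [tm_tm, tm_tm]
  exact fun B hB asg => rfl

theorem HH_var (hh : IsChoice V h) (x : Fin 4) : HH h (.var x) = x := by
  have h1 : Idem V (Trm.var (x, 0) : Trm σ BV) := fun B hB c => rfl
  have h2 := hh (.var (x, 0)) (.var (x, 0)) h1 h1 BV (fun y => y) (fun _ => (x, 0)) (fun B hB asg => rfl)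
  change (h (.var (x, 0))).1 = x
  rw [h2]

theorem HH_resp (hh : IsChoice V h) {u u' : Trm σ (Fin 4)} (hu : Idem V u) (hv : VEq V u u') :
    HH h u = HH h u' := by
  have hu' : Idem V u' := fun B hB c => (hv B hB _).symm.trans (hu B hB c)
  refine congrArg Prod.fst (hh _ _ (hu.map _) (hu'.map _) BV (fun y => y) (fun y => y) ?_)
  exact (hv.map _).map _

/-- The congruence attached to a kernel on `Fin 4`. -/
def hat (V : Variety σ) (h : Trm σ BV → BV) (e : Fin 4 → Fin 4) : Congruence (TA σ (Fin 4)) :=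
  mkCong (A := TA σ (Fin 4))
    (fun s s' => (kC V (Fin 4)).rel s s' ∧ ∀ r : Trm σ (Option (Fin 4)), Idem V (plug r s) →
      e (HH h (plug r s)) = e (HH h (plug r s')))
    ⟨fun s => ⟨(kC V (Fin 4)).iseqv.refl s, fun r _ => rfl⟩,
      fun k => ⟨(kC V (Fin 4)).iseqv.symm k.1, fun r hr =>
        (k.2 r (kC_idem (plug_k r ((kC V (Fin 4)).iseqv.symm k.1)) hr)).symm⟩,
      fun k k' => ⟨(kC V (Fin 4)).iseqv.trans k.1 k'.1, fun r hr =>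
        (k.2 r hr).trans (k'.2 r (kC_idem (plug_k r k.1) hr))⟩⟩
    (by
      intro f c i s s' k
      refine ⟨?_, fun r hr => ?_⟩
      · apply (kC V (Fin 4)).compat
        intro j
        by_cases hj : j = i
        · subst hj; simpa using k.1
        · simpa [hj] using (kC V (Fin 4)).iseqv.refl (c j)
      · let r' : Trm σ (Option (Fin 4)) :=
          tb (oe (.op f fun j => if j = i then .var none else tm some (c j)) (fun x => .var (some x))) r
        have key : ∀ s : Trm σ (Fin 4), plug r' s = plug r (Trm.op f (Function.update c i s)) := by
          intro s
          rw [plug, plug, tb_tb]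
          congr 1; funext o
          cases o with
          | some x => rfl
          | none =>
            change Trm.op f _ = Trm.op f _
            congr 1; funext j
            by_cases hj : j = i
            · subst hj; simp [tb, oe]
            · simp only [hj, if_false, tm, tb_tb, ne_eq, not_false_eq_true, Function.update_of_ne]
              exact tm_id (c j)
        have := k.2 r' (by rw [key]; exact hr)
        rwa [key, key] at this)

theorem hat_veq (hh : IsChoice V h) (e : Fin 4 → Fin 4) {s s' : Trm σ (Fin 4)} (hv : VEq V s s') :
    (hat V h e).rel s s' := by
  refine ⟨fun B hB z => hv B hB _, fun r hr => congrArg e (HH_resp hh hr ?_)⟩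
  intro B hB asg
  rw [plug, plug, eval_tb, eval_tb]
  congr 1; funext o
  cases o
  · exact hv B hB asg
  · rfl

theorem hat_var (hh : IsChoice V h) (e : Fin 4 → Fin 4) {x x' : Fin 4} (hx : e x = e x') :
    (hat V h e).rel (.var x : Trm σ (Fin 4)) (.var x' : Trm σ (Fin 4)) := by
  refine ⟨fun B hB z => rfl, fun r hr => ?_⟩
  let P : Trm σ BV := tm (oe (0, 0) (fun y => (y, 2))) r
  let g : Fin 4 → BV → Fin 4 := fun x y => if y.2 = 0 then x else y.1
  have key : ∀ x : Fin 4, plug r (.var x) = tm (g x) P := by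
    intro x
    rw [plug, tm_tm, tm]
    congr 1; funext o
    cases o <;> simp [oe, g]
  have hP : Idem V P := by
    intro B hB c
    have := hr B hB c
    rw [key, eval_tm] at this
    exact this
  rw [key, key, HH_map hh P hP, HH_map hh P hP]
  simp only [g]
  split_ifs
  · exact hx
  · rfl

theorem block_logic {p q r s : BV} {g0 g1 : BV → BV}
    (d0 : g0 = fun y => if y.2 = 0 then (0, 0) else y) (d1 : g1 = fun y => if y.2 = 1 then (0, 1) else y)
    (h1 : g0 p = g0 r) (h2 : g0 q = g0 s) (h3 : g1 p = g1 q) (h4 : g1 r = g1 s)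
    (e : Fin 4 → Fin 4) (he : e p.1 = e q.1) : e r.1 = e s.1 := by
  subst d0 d1
  obtain ⟨p1, p2⟩ := p
  obtain ⟨q1, q2⟩ := q
  obtain ⟨r1, r2⟩ := r
  obtain ⟨s1, s2⟩ := s
  simp only at *
  by_cases a : p2 = 0 <;> by_cases b : q2 = 0 <;> by_cases c : r2 = 0 <;> by_cases d : s2 = 0 <;>
  by_cases a' : p2 = 1 <;> by_cases b' : q2 = 1 <;> by_cases c' : r2 = 1 <;> by_cases d' : s2 = 1 <;>
  simp_all

theorem hat_centralizes (hh : IsChoice V h) (e : Fin 4 → Fin 4) :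
    Centralizes (kC V (Fin 4)) (kC V (Fin 4)) (hat V h e) := by
  intro m n t a b u v hab huv hp
  have hk : ∀ (a b : Fin m → Trm σ (Fin 4)) (u v : Fin n → Trm σ (Fin 4)),
      (∀ i, (kC V (Fin 4)).rel (a i) (b i)) → (∀ i, (kC V (Fin 4)).rel (u i) (v i)) →
      (kC V (Fin 4)).rel ((TA σ (Fin 4)).evalTrm (Sum.elim a u) t)
        ((TA σ (Fin 4)).evalTrm (Sum.elim b v) t) := by
    intro a b u v hab huv
    apply cong_term
    rintro (i | i)
    · exact hab i
    · exact huv i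
  have rf := fun s : Trm σ (Fin 4) => (kC V (Fin 4)).iseqv.refl s
  refine ⟨hk b b u v (fun i => rf _) huv, fun r hr => ?_⟩
  let tt : Trm σ (Option (Fin 4) ⊕ (Fin m ⊕ Fin n)) :=
    tb (oe (tm Sum.inr t) (fun x => .var (.inl (some x)))) r
  let bl : (Fin m → Trm σ (Fin 4)) → (Fin n → Trm σ (Fin 4)) → Trm σ BV := fun a u =>
    tb (oe (tb (Sum.elim (fun i => tm (fun x => ((x, 0) : BV)) (a i))
      (fun i => tm (fun x => ((x, 1) : BV)) (u i))) t) (fun x => .var (x, 2))) r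
  have key : ∀ a u, tm Prod.fst (bl a u) = plug r ((TA σ (Fin 4)).evalTrm (Sum.elim a u) t) := by
    intro a u
    rw [TA_eval, plug, tm, tb_tb]
    congr 1; funext o
    cases o with
    | some x => rfl
    | none =>
      simp only [oe, Option.elim]
      rw [tb_tb]
      congr 1; funext k
      rcases k with i | i
      · exact (tm_tm _ _ _).trans (tm_id _)
      · exact (tm_tm _ _ _).trans (tm_id _)
  have hid : ∀ a u, Idem V (plug r ((TA σ (Fin 4)).evalTrm (Sum.elim a u) t)) → Idem V (bl a u) := by
    intro a u hi B hB c
    have := hi B hB c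
    rw [← key, eval_tm] at this
    exact this
  have evbl : ∀ (B : Alg σ) (asg : BV → B.carrier) a u, B.evalTrm asg (bl a u) =
      B.evalTrm (oe (B.evalTrm (Sum.elim (fun i => B.evalTrm (fun x => asg (x, 0)) (a i))
        (fun i => B.evalTrm (fun x => asg (x, 1)) (u i))) t) (fun x => asg (x, 2))) r := by
    intro B asg a u
    simp only [bl]
    rw [eval_tb]
    congr 1; funext o
    cases o with
    | some x => rfl
    | none =>
      simp only [oe, Option.elim]
      rw [eval_tb]
      congr 1; funext k
      rcases k with i | i
      · exact eval_tm _ _ _ _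
      · exact eval_tm _ _ _ _
  let g0 : BV → BV := fun y => if y.2 = 0 then (0, 0) else y
  let g1 : BV → BV := fun y => if y.2 = 1 then (0, 1) else y
  have c0 : ∀ u, VEq V (tm g0 (bl a u)) (tm g0 (bl b u)) := by
    intro u B hB asg
    rw [eval_tm, eval_tm, evbl, evbl]
    have : (fun i => B.evalTrm (fun x => asg (g0 (x, 0))) (a i)) =
        fun i => B.evalTrm (fun x => asg (g0 (x, 0))) (b i) := by
      funext i
      exact hab i B hB (asg (0, 0))
    rw [this]
  have c1 : ∀ a, VEq V (tm g1 (bl a u)) (tm g1 (bl a v)) := by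
    intro a B hB asg
    rw [eval_tm, eval_tm, evbl, evbl]
    have : (fun i => B.evalTrm (fun x => asg (g1 (x, 1))) (u i)) =
        fun i => B.evalTrm (fun x => asg (g1 (x, 1))) (v i) := by
      funext i
      exact huv i B hB (asg (0, 1))
    rw [this]
  have sy : ∀ i, (kC V (Fin 4)).rel (b i) (a i) := fun i => (kC V (Fin 4)).iseqv.symm (hab i)
  have iau := kC_idem (plug_k r (hk b a u u sy (fun i => rf _))) hr
  have iav := kC_idem (plug_k r (hk b a u v sy huv)) hr
  have ibv := kC_idem (plug_k r (hk b b u v (fun i => rf _) huv)) hr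
  have hE := hp.2 r iau
  rw [← key, ← key, HH_map hh _ (hid _ _ iau), HH_map hh _ (hid _ _ iav)] at hE
  rw [← key, ← key, HH_map hh _ (hid _ _ hr), HH_map hh _ (hid _ _ ibv)]
  exact block_logic (g0 := g0) (g1 := g1) rfl rfl
    (hh _ _ (hid _ _ iau) (hid _ _ hr) BV g0 g0 (c0 u))
    (hh _ _ (hid _ _ iav) (hid _ _ ibv) BV g0 g0 (c0 v))
    (hh _ _ (hid _ _ iau) (hid _ _ iav) BV g1 g1 (c1 a))
    (hh _ _ (hid _ _ hr) (hid _ _ ibv) BV g1 g1 (c1 b)) e hE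

theorem kC_le {c : Congruence (TA σ (Fin 4))}
    (hv : ∀ s s' : Trm σ (Fin 4), VEq V s s' → c.rel s s')
    (hx : ∀ x : Fin 4, c.rel (Trm.var x : Trm σ (Fin 4)) (Trm.var 0 : Trm σ (Fin 4))) :
    kC V (Fin 4) ≤ c := by
  intro s s' hs
  have h1 : ∀ s : Trm σ (Fin 4), c.rel s (tm (fun _ => (0 : Fin 4)) s) := by
    intro s
    have := cong_term c s (fun x => (Trm.var x : Trm σ (Fin 4)))
      (fun _ => (Trm.var 0 : Trm σ (Fin 4))) hx
    rw [TA_eval, TA_eval] at this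
    have e : tb (fun x => (Trm.var x : Trm σ (Fin 4))) s = s := tm_id s
    rw [e] at this
    exact this
  refine c.iseqv.trans (h1 s) (c.iseqv.trans (hv _ _ ?_) (c.iseqv.symm (h1 s')))
  intro B hB asg
  rw [eval_tm, eval_tm]
  exact hs B hB _

theorem no_choice (h5 : NoPent V) (hh : IsChoice V h) : False := by
  let ZC := hat V h (fun x => x)
  let BC := hat V h ![0, 1, 0, 1]
  let DC := hat V h ![0, 0, 2, 3]
  let TC := hat V h ![0, 0, 2, 2]
  have zle : ∀ e, ZC ≤ hat V h e := fun e s s' k => ⟨k.1, fun r hr => congrArg e (k.2 r hr)⟩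
  have lek : ∀ e, hat V h e ≤ kC V (Fin 4) := fun e s s' k => k.1
  have dt : DC ≤ TC := fun s s' k => ⟨k.1, fun r hr => by
    have := k.2 r hr
    generalize HH h (plug r s) = p at this ⊢
    generalize HH h (plug r s') = q at this ⊢
    revert p q; decide⟩
  have bt : ∀ s s', BC.rel s s' → TC.rel s s' → ZC.rel s s' := fun s s' k k' => ⟨k.1, fun r hr => by
    have h1 := k.2 r hr
    have h2 := k'.2 r hr
    generalize HH h (plug r s) = p at h1 h2 ⊢
    generalize HH h (plug r s') = q at h1 h2 ⊢
    revert p q; decide⟩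
  have ndt : ¬ TC ≤ DC := by
    intro hle
    have h1 : TC.rel (.var 2 : Trm σ (Fin 4)) (.var 3 : Trm σ (Fin 4)) := hat_var hh _ rfl
    have h2 := (hle _ _ h1).2 (.var none) (fun B hB c => rfl)
    change (![0, 0, 2, 3] : Fin 4 → Fin 4) (HH h (.var 2)) =
      (![0, 0, 2, 3] : Fin 4 → Fin 4) (HH h (.var 3)) at h2
    rw [HH_var hh, HH_var hh] at h2
    revert h2; decide
  have lk : ∀ c : Congruence (TA σ (Fin 4)), BC ≤ c → DC ≤ c → kC V (Fin 4) ≤ c := by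
    intro c hb hd
    refine kC_le (fun s s' hv => hb _ _ (hat_veq hh _ hv)) ?_
    have d10 : c.rel (.var 1 : Trm σ (Fin 4)) (.var 0 : Trm σ (Fin 4)) := hd _ _ (hat_var hh _ rfl)
    have b20 : c.rel (.var 2 : Trm σ (Fin 4)) (.var 0 : Trm σ (Fin 4)) := hb _ _ (hat_var hh _ rfl)
    have b31 : c.rel (.var 3 : Trm σ (Fin 4)) (.var 1 : Trm σ (Fin 4)) := hb _ _ (hat_var hh _ rfl)
    intro x
    fin_cases x
    exacts [c.iseqv.refl _, d10, b20, c.iseqv.trans b31 d10]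
  have mono : ∀ {c d : Congruence (TA σ (Fin 4))} (hc : ZC ≤ c) (hd : ZC ≤ d), c ≤ d →
      push ZC c hc ≤ push ZC d hd := fun hc hd hcd p q k => hcd _ _ k
  have join : ∀ c : Congruence (quotAlg (TA σ (Fin 4)) ZC), push ZC BC (zle _) ≤ c →
      push ZC DC (zle _) ≤ c → push ZC (kC V (Fin 4)) (lek _) ≤ c := by
    intro c hb hd p q k
    have := lk (pull ZC c) (fun s s' m => hb _ _ (push_rel.2 m)) (fun s s' m => hd _ _ (push_rel.2 m)) _ _ k
    change c.rel _ _ at this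
    rwa [qm_qo, qm_qo] at this
  have mb : push ZC BC (zle _) ⊓ push ZC TC (zle _) = ⊥ := by
    apply le_antisymm _ bot_le
    rw [← push_bot]
    intro p q k
    rw [inf_rel] at k
    exact bt _ _ k.1 k.2
  have mdt := mono (c := DC) (d := TC) (zle _) (zle _) dt
  have mbk := mono (c := BC) (zle _) (lek _) (lek _)
  have mtk := mono (c := TC) (zle _) (lek _) (lek _)
  refine h5 (quotAlg (TA σ (Fin 4)) ZC) (quot_mem V ZC fun s t hv => hat_veq hh _ hv)
    ⟨push ZC (kC V (Fin 4)) (lek _), push ZC BC (zle _), push ZC DC (zle _), push ZC TC (zle _),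
      ⟨⟨mdt, ?_⟩, mb, ?_, ?_, ?_⟩, ?_, ?_⟩
  · intro hle
    exact ndt fun s s' m => push_rel.1 (hle _ _ (push_rel.2 m))
  · exact le_antisymm ((inf_le_inf_left _ mdt).trans mb.le) bot_le
  · exact le_antisymm (sup_le mbk (mdt.trans mtk)) (join _ le_sup_left le_sup_right)
  · exact le_antisymm (sup_le mbk mtk) (join _ le_sup_left (mdt.trans le_sup_right))
  · rw [abelian_iff, ← push_bot]
    exact push_centralizes (hat_centralizes hh _)
  · apply push_centralizes
    intro m n t a b u v hab huv hp
    exact hat_centralizes hh _ m n t a b u v (fun i => lek _ _ _ (hab i)) huv hp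

end choice

theorem taylor_of_noPent {V : Variety σ} (h5 : NoPent V) : TaylorLike V := by
  by_contra hn
  obtain ⟨h, hh⟩ := exists_h hn BV
  exact no_choice h5 hh

theorem five_one {V : Variety σ} (h5 : NoPent V) : ∃ d : Trm σ (Fin 3), IsWeakDifferenceTrm V d :=
  wdt_of_taylor h5 fun A hA => (taylor_of_noPent h5).taylorIn A hA

/-! ### The easy implications -/

theorem perm_of_wdt {V : Variety σ} {d : Trm σ (Fin 3)} (hd : IsWeakDifferenceTrm V d)
    (hA : V.Mem A) {α : Congruence A} (hα : IsAbelianCong α) {x y : Congruence A} (hx : x ≤ α)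
    (hy : y ≤ α) {a b : A.carrier} (h : ∃ c, x.rel a c ∧ y.rel c b) : ∃ c, y.rel a c ∧ x.rel c b := by
  obtain ⟨c, h1, h2⟩ := h
  refine ⟨A.evalTrm ![a, c, b] d, ?_, ?_⟩
  · have e := (hd A hA α hα a c (hx _ _ h1)).2
    have := cong_term y d ![a, c, c] ![a, c, b] (by
      intro i
      fin_cases i
      exacts [y.iseqv.refl _, y.iseqv.refl _, h2])
    rwa [e] at this
  · have e := (hd A hA α hα c b (hy _ _ h2)).1
    have := cong_term x d ![a, c, b] ![c, c, b] (by
      intro i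
      fin_cases i
      exacts [h1, x.iseqv.refl _, x.iseqv.refl _])
    rwa [e] at this

theorem sup_of_perm {x y : Congruence A} (hp : Permutes x y) {a b : A.carrier}
    (h : (x ⊔ y).rel a b) : ∃ c, x.rel a c ∧ y.rel c b := by
  let e : Congruence A :=
    { rel := fun a b => ∃ c, x.rel a c ∧ y.rel c b
      iseqv := ⟨fun a => ⟨a, x.iseqv.refl a, y.iseqv.refl a⟩, by
        rintro a b ⟨c, h1, h2⟩
        exact (hp b a).2 ⟨c, y.iseqv.symm h2, x.iseqv.symm h1⟩, by
        rintro a b d ⟨c, h1, h2⟩ ⟨c', h3, h4⟩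
        obtain ⟨f, h5, h6⟩ := (hp c c').2 ⟨b, h2, h3⟩
        exact ⟨f, x.iseqv.trans h1 h5, y.iseqv.trans h6 h4⟩⟩
      compat := by
        intro f a b hab
        choose c h1 h2 using hab
        exact ⟨A.interp f c, x.compat f _ _ h1, y.compat f _ _ h2⟩ }
  have : x ⊔ y ≤ e := sup_le (fun a b h => ⟨b, h, y.iseqv.refl b⟩) (fun a b h => ⟨a, x.iseqv.refl a, h⟩)
  exact this _ _ h

end WD

/-- Characterization of varieties with a weak difference term. -/
theorem characterization_of_weak_difference_term {σ : Sig} (V : Variety σ) :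
    List.TFAE [
      -- (1) V has a weak difference term
      ∃ d : Trm σ (Fin 3), IsWeakDifferenceTrm V d,
      -- (2) below any abelian congruence, congruences pairwise permute
      ∀ A : Alg σ, V.Mem A → ∀ α : Congruence A, IsAbelianCong α →
        ∀ x y : Congruence A, x ≤ α → y ≤ α → Permutes x y,
      -- (3) the interval I[0,α] is modular whenever α is abelian
      ∀ A : Alg σ, V.Mem A → ∀ α : Congruence A, IsAbelianCong α →
        ∀ x y z : Congruence A, x ≤ α → y ≤ α → z ≤ α → x ≤ z →
          x ⊔ (y ⊓ z) = (x ⊔ y) ⊓ z,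
      -- (4) no spanning pentagon in I[0,α] when α is abelian
      ∀ A : Alg σ, V.Mem A → ∀ α : Congruence A, IsAbelianCong α →
        ¬ ∃ β δ θ : Congruence A, IsPentagon ⊥ β δ θ α,
      -- (5) no spanning pentagon with [α,α] = 0 and C(θ,α;δ)
      ∀ A : Alg σ, V.Mem A →
        ¬ ∃ α β δ θ : Congruence A, IsPentagon ⊥ β δ θ α ∧
          IsAbelianCong α ∧ Centralizes θ α δ ] := by
  tfae_have 1 → 2 := by
    rintro ⟨d, hd⟩ A hA α hα x y hx hy a b
    exact ⟨WD.perm_of_wdt hd hA hα hx hy, WD.perm_of_wdt hd hA hα hy hx⟩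
  tfae_have 2 → 3 := by
    intro h A hA α hα x y z hx hy hz hxz
    apply le_antisymm
    · exact sup_le (le_inf le_sup_left hxz) (inf_le_inf_right _ le_sup_right)
    · intro a b hab
      rw [WD.inf_rel] at hab
      obtain ⟨c, h1, h2⟩ := WD.sup_of_perm (h A hA α hα x y hx hy) hab.1
      refine (x ⊔ y ⊓ z).iseqv.trans ((le_sup_left : x ≤ x ⊔ y ⊓ z) _ _ h1)
        ((le_sup_right : y ⊓ z ≤ x ⊔ y ⊓ z) _ _ (WD.inf_rel.2 ⟨h2, ?_⟩))
      exact z.iseqv.trans (z.iseqv.symm (hxz _ _ h1)) hab.2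
  tfae_have 3 → 4 := by
    rintro h A hA α hα ⟨β, δ, θ, hlt, h1, h2, h3, h4⟩
    have hβ : β ≤ α := h3 ▸ le_sup_left
    have hδ : δ ≤ α := h3 ▸ le_sup_right
    have hθ : θ ≤ α := h4 ▸ le_sup_right
    have := h A hA α hα δ β θ hδ hβ hθ hlt.le
    rw [h1, sup_bot_eq, sup_comm, h3, inf_eq_right.2 hθ] at this
    exact hlt.ne this
  tfae_have 4 → 5 := by
    rintro h A hA ⟨α, β, δ, θ, hp, ha, _⟩
    exact h A hA α ha ⟨β, δ, θ, hp⟩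
  tfae_have 5 → 1 := fun h => WD.five_one h
  tfae_finish
end
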